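/- arXiv:2105.08434 — 2 statements merged into one kernel-verified Lean document; each statement's English description precedes it below -/
import Mathlib

section
/- Let α ∈ (0,π), let σ : ℝ → ℝ be smooth with σ'(r) = 0 for all r ∉ (−1,1), and let v : ℝ × [0,∞) → ℝ be smooth with: (i) −div(A_α ∇v) + f'(v) = 0 in ℝ × (0,∞); (ii) N_{∂ℝ²₊} · A_α ∇v(R,0) + σ'(v(R,0)) = 0 for all R ∈ ℝ; (iii) for all k, l ∈ ℕ₀ there are c, C > 0 with |∂_R^k ∂_H^l(v(R,H) − θ₀(R))| ≤ C e^{−c(|R|+H)}. Let u : ℝ × [0,∞) → ℝ be smooth such that for all k, l ∈ ℕ₀ with k + l ≤ 2 there are c, C > 0 with |∂_R^k ∂_H^l u(R,H)| ≤ C e^{−c(|R|+H)} for all (R,H). Define G := −div(A_α ∇u) + f''(v) u on ℝ × (0,∞) and g(R) := N_{∂ℝ²₊} · A_α ∇u(R,0) + σ''(v(R,0)) u(R,0) for R ∈ ℝ. Then ∫_{ℝ×(0,∞)} G · ∂_R v d(R,H) + ∫_ℝ g(R) ∂_R v(R,0) dR = 0. -/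
open Filter Topology MeasureTheory Real

/-- Partial derivative in the first variable `R` of `g : ℝ → ℝ → ℝ`. -/
noncomputable def pdR (g : ℝ → ℝ → ℝ) : ℝ → ℝ → ℝ :=
  fun R H => deriv (fun r => g r H) R

/-- Partial derivative in the second variable `H` of `g : ℝ → ℝ → ℝ`. -/
noncomputable def pdH (g : ℝ → ℝ → ℝ) : ℝ → ℝ → ℝ :=
  fun R H => deriv (fun h => g R h) H

/-- Mixed derivative `∂_R^k ∂_H^l g`. -/
noncomputable def pdMix (k l : ℕ) (g : ℝ → ℝ → ℝ) : ℝ → ℝ → ℝ :=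
  fun R H => iteratedDeriv k (fun r => iteratedDeriv l (fun h => g r h) H) R

section PartialDerivatives

variable {g : ℝ → ℝ → ℝ}

theorem pdR_eq_fderiv (hg : ContDiff ℝ (⊤ : ℕ∞) (fun p : ℝ × ℝ => g p.1 p.2)) (R H : ℝ) :
    pdR g R H = fderiv ℝ (fun p : ℝ × ℝ => g p.1 p.2) (R, H) (1, 0) := by
  have h₁ : HasFDerivAt (fun p : ℝ × ℝ => g p.1 p.2) _ (R, H) :=
    (hg.differentiable (by simp) (R, H)).hasFDerivAt
  exact (h₁.comp_hasDerivAt R ((hasDerivAt_id R).prodMk (hasDerivAt_const R H))).deriv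

theorem pdH_eq_fderiv (hg : ContDiff ℝ (⊤ : ℕ∞) (fun p : ℝ × ℝ => g p.1 p.2)) (R H : ℝ) :
    pdH g R H = fderiv ℝ (fun p : ℝ × ℝ => g p.1 p.2) (R, H) (0, 1) := by
  have h₁ : HasFDerivAt (fun p : ℝ × ℝ => g p.1 p.2) _ (R, H) :=
    (hg.differentiable (by simp) (R, H)).hasFDerivAt
  exact (h₁.comp_hasDerivAt H ((hasDerivAt_const H R).prodMk (hasDerivAt_id H))).deriv

theorem contDiff_pdR (hg : ContDiff ℝ (⊤ : ℕ∞) (fun p : ℝ × ℝ => g p.1 p.2)) :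
    ContDiff ℝ (⊤ : ℕ∞) (fun p : ℝ × ℝ => pdR g p.1 p.2) := by
  simp only [pdR_eq_fderiv hg]
  exact (hg.fderiv_right (by simp)).clm_apply contDiff_const

theorem contDiff_pdH (hg : ContDiff ℝ (⊤ : ℕ∞) (fun p : ℝ × ℝ => g p.1 p.2)) :
    ContDiff ℝ (⊤ : ℕ∞) (fun p : ℝ × ℝ => pdH g p.1 p.2) := by
  simp only [pdH_eq_fderiv hg]
  exact (hg.fderiv_right (by simp)).clm_apply contDiff_const

theorem hasDerivAt_pdR (hg : ContDiff ℝ (⊤ : ℕ∞) (fun p : ℝ × ℝ => g p.1 p.2)) (R H : ℝ) :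
    HasDerivAt (fun r => g r H) (pdR g R H) R := by
  have h : ContDiff ℝ (⊤ : ℕ∞) (fun r => g r H) := hg.comp (contDiff_id.prodMk contDiff_const)
  exact (h.differentiable (by simp) R).hasDerivAt

theorem hasDerivAt_pdH (hg : ContDiff ℝ (⊤ : ℕ∞) (fun p : ℝ × ℝ => g p.1 p.2)) (R H : ℝ) :
    HasDerivAt (fun h => g R h) (pdH g R H) H := by
  have h : ContDiff ℝ (⊤ : ℕ∞) (fun h => g R h) := hg.comp (contDiff_const.prodMk contDiff_id)
  exact (h.differentiable (by simp) H).hasDerivAt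

theorem pdH_pdR (hg : ContDiff ℝ (⊤ : ℕ∞) (fun p : ℝ × ℝ => g p.1 p.2)) :
    pdH (pdR g) = pdR (pdH g) := by
  funext R H
  have hd : DifferentiableAt ℝ (fderiv ℝ (fun p : ℝ × ℝ => g p.1 p.2)) (R, H) :=
    (hg.fderiv_right (m := (⊤ : ℕ∞)) (by simp)).differentiable (by simp) _
  rw [pdH_eq_fderiv (contDiff_pdR hg), pdR_eq_fderiv (contDiff_pdH hg)]
  simp only [pdR_eq_fderiv hg, pdH_eq_fderiv hg]
  rw [fderiv_clm_apply (c := fderiv ℝ (fun p : ℝ × ℝ => g p.1 p.2)) hd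
      (differentiableAt_const _),
    fderiv_clm_apply (c := fderiv ℝ (fun p : ℝ × ℝ => g p.1 p.2)) hd
      (differentiableAt_const _)]
  simpa using ((contDiff_infty.1 hg 2).contDiffAt.isSymmSndFDerivAt (by simp)) (0, 1) (1, 0)

end PartialDerivatives

/-- Exponential decay on the closed upper half-plane. -/
def ExpDecay (φ : ℝ → ℝ → ℝ) : Prop :=
  ∃ c > (0:ℝ), ∃ C > (0:ℝ), ∀ R : ℝ, ∀ H : ℝ, 0 ≤ H →
    |φ R H| ≤ C * Real.exp (-c * (|R| + H))

/-- Boundedness on the closed upper half-plane. -/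
def BddHalfPlane (φ : ℝ → ℝ → ℝ) : Prop :=
  ∃ C : ℝ, ∀ R : ℝ, ∀ H : ℝ, 0 ≤ H → |φ R H| ≤ C

section Decay

variable {φ ψ : ℝ → ℝ → ℝ}

theorem ExpDecay.bdd (hφ : ExpDecay φ) : BddHalfPlane φ := by
  obtain ⟨c, hc, C, hC, h⟩ := hφ
  refine ⟨C, fun R H hH => (h R H hH).trans (mul_le_of_le_one_right hC.le ?_)⟩
  rw [Real.exp_le_one_iff]
  have := mul_nonneg hc.le (add_nonneg (abs_nonneg R) hH)
  linarith

theorem ExpDecay.add (hφ : ExpDecay φ) (hψ : ExpDecay ψ) :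
    ExpDecay (fun R H => φ R H + ψ R H) := by
  obtain ⟨c, hc, C, hC, h⟩ := hφ
  obtain ⟨d, hd, D, hD, k⟩ := hψ
  refine ⟨min c d, lt_min hc hd, C + D, add_pos hC hD, fun R H hH => ?_⟩
  have hs : 0 ≤ |R| + H := add_nonneg (abs_nonneg R) hH
  have h₁ : Real.exp (-c * (|R| + H)) ≤ Real.exp (-(min c d) * (|R| + H)) := by
    gcongr
    exact min_le_left c d
  have h₂ : Real.exp (-d * (|R| + H)) ≤ Real.exp (-(min c d) * (|R| + H)) := by
    gcongr
    exact min_le_right c d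
  calc |φ R H + ψ R H| ≤ |φ R H| + |ψ R H| := abs_add_le _ _
    _ ≤ C * Real.exp (-c * (|R| + H)) + D * Real.exp (-d * (|R| + H)) :=
        add_le_add (h R H hH) (k R H hH)
    _ ≤ C * Real.exp (-(min c d) * (|R| + H)) + D * Real.exp (-(min c d) * (|R| + H)) := by
        gcongr
    _ = _ := by ring

theorem BddHalfPlane.mul_expDecay (hφ : BddHalfPlane φ) (hψ : ExpDecay ψ) :
    ExpDecay (fun R H => φ R H * ψ R H) := by
  obtain ⟨C, h⟩ := hφ
  obtain ⟨d, hd, D, hD, k⟩ := hψ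
  refine ⟨d, hd, (|C| + 1) * D, by positivity, fun R H hH => ?_⟩
  rw [abs_mul, mul_assoc]
  have h₁ : |φ R H| ≤ |C| + 1 := (h R H hH).trans ((le_abs_self C).trans (by linarith))
  exact mul_le_mul h₁ (k R H hH) (abs_nonneg _) (by positivity)

theorem bddHalfPlane_const (a : ℝ) : BddHalfPlane (fun _ _ => a) :=
  ⟨|a|, fun _ _ _ => le_rfl⟩

theorem BddHalfPlane.add (hφ : BddHalfPlane φ) (hψ : BddHalfPlane ψ) :
    BddHalfPlane (fun R H => φ R H + ψ R H) := by
  obtain ⟨C, h⟩ := hφ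
  obtain ⟨D, k⟩ := hψ
  exact ⟨C + D, fun R H hH => (abs_add_le _ _).trans (add_le_add (h R H hH) (k R H hH))⟩

theorem BddHalfPlane.mul (hφ : BddHalfPlane φ) (hψ : BddHalfPlane ψ) :
    BddHalfPlane (fun R H => φ R H * ψ R H) := by
  obtain ⟨C, h⟩ := hφ
  obtain ⟨D, k⟩ := hψ
  refine ⟨C * D, fun R H hH => ?_⟩
  rw [abs_mul]
  exact mul_le_mul (h R H hH) (k R H hH) (abs_nonneg _) ((abs_nonneg _).trans (h R H hH))

theorem BddHalfPlane.sub_const_mul (a : ℝ) (hφ : BddHalfPlane φ) (hψ : BddHalfPlane ψ) :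
    BddHalfPlane (fun R H => φ R H - a * ψ R H) := by
  simpa only [sub_eq_add_neg, neg_mul] using hφ.add ((bddHalfPlane_const (-a)).mul hψ)

theorem ExpDecay.sub_const_mul (a : ℝ) (hφ : ExpDecay φ) (hψ : ExpDecay ψ) :
    ExpDecay (fun R H => φ R H - a * ψ R H) := by
  simpa only [sub_eq_add_neg, neg_mul] using hφ.add ((bddHalfPlane_const (-a)).mul_expDecay hψ)

theorem ExpDecay.mul_bdd (hφ : ExpDecay φ) (hψ : BddHalfPlane ψ) :
    ExpDecay (fun R H => φ R H * ψ R H) := by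
  simpa only [mul_comm] using hψ.mul_expDecay hφ

theorem ExpDecay.sub (hφ : ExpDecay φ) (hψ : ExpDecay ψ) :
    ExpDecay (fun R H => φ R H - ψ R H) := by
  simpa only [one_mul] using hφ.sub_const_mul 1 hψ

theorem integrable_exp_neg_mul_abs {c : ℝ} (hc : 0 < c) :
    Integrable (fun x : ℝ => Real.exp (-c * |x|)) := by
  rw [← integrableOn_univ, ← Set.Iic_union_Ioi (a := (0:ℝ)), integrableOn_union]
  constructor
  · refine (integrableOn_exp_mul_Iic hc 0).congr_fun (fun x hx => ?_) measurableSet_Iic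
    simp [abs_of_nonpos (Set.mem_Iic.1 hx)]
  · refine (exp_neg_integrableOn_Ioi 0 hc).congr_fun (fun x hx => ?_) measurableSet_Ioi
    simp [abs_of_pos (Set.mem_Ioi.1 hx)]

theorem ExpDecay.integrableOn (hφ : ExpDecay φ)
    (hcont : Continuous (fun p : ℝ × ℝ => φ p.1 p.2)) :
    IntegrableOn (fun p : ℝ × ℝ => φ p.1 p.2) (Set.univ ×ˢ Set.Ioi (0:ℝ)) := by
  obtain ⟨c, hc, C, hC, h⟩ := hφ
  have hint : IntegrableOn
      (fun p : ℝ × ℝ => Real.exp (-c * |p.1|) * (C * Real.exp (-c * p.2)))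
      (Set.univ ×ˢ Set.Ioi (0:ℝ)) := by
    rw [IntegrableOn, Measure.volume_eq_prod, ← Measure.prod_restrict, Measure.restrict_univ]
    exact (integrable_exp_neg_mul_abs hc).mul_prod ((exp_neg_integrableOn_Ioi 0 hc).const_mul C)
  refine hint.mono' hcont.aestronglyMeasurable ?_
  filter_upwards [ae_restrict_mem (MeasurableSet.univ.prod measurableSet_Ioi)] with p hp
  refine (h p.1 p.2 (le_of_lt hp.2)).trans_eq ?_
  rw [mul_add, Real.exp_add]
  ring

theorem ExpDecay.integrable_left (hφ : ExpDecay φ)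
    (hcont : Continuous (fun p : ℝ × ℝ => φ p.1 p.2)) {H : ℝ} (hH : 0 ≤ H) :
    Integrable (fun R => φ R H) := by
  obtain ⟨c, hc, C, hC, h⟩ := hφ
  refine (((integrable_exp_neg_mul_abs hc).const_mul (C * Real.exp (-c * H)))).mono'
    (hcont.comp (continuous_id.prodMk continuous_const)).aestronglyMeasurable (ae_of_all _ ?_)
  intro R
  refine (h R H hH).trans_eq ?_
  rw [mul_add, Real.exp_add]
  ring

theorem ExpDecay.integrableOn_right (hφ : ExpDecay φ)
    (hcont : Continuous (fun p : ℝ × ℝ => φ p.1 p.2)) (R : ℝ) :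
    IntegrableOn (fun H => φ R H) (Set.Ioi 0) := by
  obtain ⟨c, hc, C, hC, h⟩ := hφ
  refine ((exp_neg_integrableOn_Ioi 0 hc).const_mul (C * Real.exp (-c * |R|))).mono'
    (hcont.comp (continuous_const.prodMk continuous_id)).aestronglyMeasurable ?_
  filter_upwards [ae_restrict_mem measurableSet_Ioi] with H hH
  refine (h R H (le_of_lt hH)).trans_eq ?_
  rw [mul_add, Real.exp_add]
  ring

theorem ExpDecay.tendsto_zero {ι : Type*} {l : Filter ι} {r s : ι → ℝ} (hφ : ExpDecay φ)
    (hs : ∀ᶠ i in l, 0 ≤ s i) (hrs : Tendsto (fun i => |r i| + s i) l atTop) :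
    Tendsto (fun i => φ (r i) (s i)) l (𝓝 0) := by
  obtain ⟨c, hc, C, hC, h⟩ := hφ
  have hexp : Tendsto (fun i => C * Real.exp (-c * (|r i| + s i))) l (𝓝 0) := by
    simpa using (Real.tendsto_exp_atBot.comp
      (hrs.const_mul_atTop_of_neg (neg_lt_zero.2 hc))).const_mul C
  refine squeeze_zero_norm' ?_ hexp
  filter_upwards [hs] with i hi
  exact h _ _ hi

/-- The divergence theorem on the upper half-plane for exponentially decaying vector fields. -/
theorem integral_divergence_halfPlane {F₁ F₂ D₁ D₂ : ℝ → ℝ → ℝ}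
    (hF₁ : ExpDecay F₁) (hF₂ : ExpDecay F₂) (hD₁ : ExpDecay D₁) (hD₂ : ExpDecay D₂)
    (hD₁c : Continuous (fun p : ℝ × ℝ => D₁ p.1 p.2))
    (hD₂c : Continuous (fun p : ℝ × ℝ => D₂ p.1 p.2))
    (h₁ : ∀ R H, HasDerivAt (fun r => F₁ r H) (D₁ R H) R)
    (h₂ : ∀ R H, HasDerivAt (fun h => F₂ R h) (D₂ R H) H) :
    ∫ p in (Set.univ ×ˢ Set.Ioi (0:ℝ) : Set (ℝ × ℝ)), (D₁ p.1 p.2 + D₂ p.1 p.2)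
      = -∫ R : ℝ, F₂ R 0 := by
  have hi₁ := hD₁.integrableOn hD₁c
  have hi₂ := hD₂.integrableOn hD₂c
  have hR : ∫ p in (Set.univ ×ˢ Set.Ioi (0:ℝ) : Set (ℝ × ℝ)), D₁ p.1 p.2 = 0 := by
    rw [IntegrableOn, Measure.volume_eq_prod, ← Measure.prod_restrict] at hi₁
    rw [Measure.volume_eq_prod, ← Measure.prod_restrict, integral_prod_symm _ hi₁,
      Measure.restrict_univ]
    refine setIntegral_eq_zero_of_forall_eq_zero fun H hH => ?_
    have hH' : 0 ≤ H := le_of_lt hH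
    rw [integral_of_hasDerivAt_of_tendsto (fun R => h₁ R H) (hD₁.integrable_left hD₁c hH')
      (hF₁.tendsto_zero (Eventually.of_forall fun _ => hH')
        (tendsto_atTop_add_const_right _ H tendsto_abs_atBot_atTop))
      (hF₁.tendsto_zero (Eventually.of_forall fun _ => hH')
        (tendsto_atTop_add_const_right _ H tendsto_abs_atTop_atTop)), sub_zero]
  have hH : ∫ p in (Set.univ ×ˢ Set.Ioi (0:ℝ) : Set (ℝ × ℝ)), D₂ p.1 p.2
      = -∫ R : ℝ, F₂ R 0 := by
    rw [Measure.volume_eq_prod, setIntegral_prod _ hi₂, setIntegral_univ, ← integral_neg]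
    refine integral_congr_ae (ae_of_all _ fun R => ?_)
    simpa using integral_Ioi_of_hasDerivAt_of_tendsto (h₂ R 0).continuousAt.continuousWithinAt
      (fun H _ => h₂ R H) (hD₂.integrableOn_right hD₂c R)
      (hF₂.tendsto_zero (eventually_ge_atTop 0)
        (tendsto_atTop_add_const_left _ |R| tendsto_id))
  rw [integral_add hi₁ hi₂, hR, hH, zero_add]

/-- If `u` decays and `w` is bounded, both with their derivatives up to second order, the flux
`w A ∇u - u A ∇w` with `A = [[1, -a], [-a, 1]]` satisfies the divergence theorem. -/
theorem integral_green_halfPlane (a : ℝ) {u w : ℝ → ℝ → ℝ}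
    (hu : ContDiff ℝ (⊤ : ℕ∞) (fun p : ℝ × ℝ => u p.1 p.2))
    (hw : ContDiff ℝ (⊤ : ℕ∞) (fun p : ℝ × ℝ => w p.1 p.2))
    (u₀ : ExpDecay u) (uR : ExpDecay (pdR u)) (uH : ExpDecay (pdH u))
    (uRR : ExpDecay (pdR (pdR u))) (uRH : ExpDecay (pdR (pdH u))) (uHH : ExpDecay (pdH (pdH u)))
    (w₀ : BddHalfPlane w) (wR : BddHalfPlane (pdR w)) (wH : BddHalfPlane (pdH w))
    (wRR : BddHalfPlane (pdR (pdR w))) (wRH : BddHalfPlane (pdR (pdH w)))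
    (wHH : BddHalfPlane (pdH (pdH w))) :
    ∫ p in (Set.univ ×ˢ Set.Ioi (0:ℝ) : Set (ℝ × ℝ)),
      (w p.1 p.2 * (pdR (pdR u) p.1 p.2 - 2 * a * pdR (pdH u) p.1 p.2 + pdH (pdH u) p.1 p.2)
        - u p.1 p.2 *
          (pdR (pdR w) p.1 p.2 - 2 * a * pdR (pdH w) p.1 p.2 + pdH (pdH w) p.1 p.2))
      = -∫ R : ℝ, (w R 0 * (pdH u R 0 - a * pdR u R 0) - u R 0 * (pdH w R 0 - a * pdR w R 0)) := by
  have cu := hu.continuous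
  have cw := hw.continuous
  have cuR := (contDiff_pdR hu).continuous
  have cwR := (contDiff_pdR hw).continuous
  have cuH := (contDiff_pdH hu).continuous
  have cwH := (contDiff_pdH hw).continuous
  have cuRR := (contDiff_pdR (contDiff_pdR hu)).continuous
  have cwRR := (contDiff_pdR (contDiff_pdR hw)).continuous
  have cuRH := (contDiff_pdR (contDiff_pdH hu)).continuous
  have cwRH := (contDiff_pdR (contDiff_pdH hw)).continuous
  have cuHH := (contDiff_pdH (contDiff_pdH hu)).continuous
  have cwHH := (contDiff_pdH (contDiff_pdH hw)).continuous
  have key := integral_divergence_halfPlane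
    (F₁ := fun R H => w R H * (pdR u R H - a * pdH u R H) - u R H * (pdR w R H - a * pdH w R H))
    (F₂ := fun R H => w R H * (pdH u R H - a * pdR u R H) - u R H * (pdH w R H - a * pdR w R H))
    (D₁ := fun R H =>
      (pdR w R H * (pdR u R H - a * pdH u R H)
        + w R H * (pdR (pdR u) R H - a * pdR (pdH u) R H))
      - (pdR u R H * (pdR w R H - a * pdH w R H)
        + u R H * (pdR (pdR w) R H - a * pdR (pdH w) R H)))
    (D₂ := fun R H =>
      (pdH w R H * (pdH u R H - a * pdR u R H)
        + w R H * (pdH (pdH u) R H - a * pdR (pdH u) R H))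
      - (pdH u R H * (pdH w R H - a * pdR w R H)
        + u R H * (pdH (pdH w) R H - a * pdR (pdH w) R H)))
    ((w₀.mul_expDecay (uR.sub_const_mul a uH)).sub (u₀.mul_bdd (wR.sub_const_mul a wH)))
    ((w₀.mul_expDecay (uH.sub_const_mul a uR)).sub (u₀.mul_bdd (wH.sub_const_mul a wR)))
    (((wR.mul_expDecay (uR.sub_const_mul a uH)).add
        (w₀.mul_expDecay (uRR.sub_const_mul a uRH))).sub
      ((uR.mul_bdd (wR.sub_const_mul a wH)).add (u₀.mul_bdd (wRR.sub_const_mul a wRH))))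
    (((wH.mul_expDecay (uH.sub_const_mul a uR)).add
        (w₀.mul_expDecay (uHH.sub_const_mul a uRH))).sub
      ((uH.mul_bdd (wH.sub_const_mul a wR)).add (u₀.mul_bdd (wHH.sub_const_mul a wRH))))
    (by fun_prop) (by fun_prop)
    (fun R H => ((hasDerivAt_pdR hw R H).mul
        ((hasDerivAt_pdR (contDiff_pdR hu) R H).sub
          ((hasDerivAt_pdR (contDiff_pdH hu) R H).const_mul a))).sub
      ((hasDerivAt_pdR hu R H).mul
        ((hasDerivAt_pdR (contDiff_pdR hw) R H).sub
          ((hasDerivAt_pdR (contDiff_pdH hw) R H).const_mul a))))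
    (fun R H => by
      rw [← pdH_pdR hu, ← pdH_pdR hw]
      exact ((hasDerivAt_pdH hw R H).mul
        ((hasDerivAt_pdH (contDiff_pdH hu) R H).sub
          ((hasDerivAt_pdH (contDiff_pdR hu) R H).const_mul a))).sub
        ((hasDerivAt_pdH hu R H).mul
          ((hasDerivAt_pdH (contDiff_pdH hw) R H).sub
            ((hasDerivAt_pdH (contDiff_pdR hw) R H).const_mul a))))
  rw [← key]
  congr 1 with p
  ring

end Decay

section PerturbedProfile

variable {v : ℝ → ℝ → ℝ} {θ : ℝ → ℝ}

theorem pdR_sub_profile (hv : ContDiff ℝ (⊤ : ℕ∞) (fun p : ℝ × ℝ => v p.1 p.2))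
    (hθ : Differentiable ℝ θ) :
    pdR (fun R H => v R H - θ R) = fun R H => pdR v R H - deriv θ R := by
  funext R H
  exact ((hasDerivAt_pdR hv R H).sub (hθ R).hasDerivAt).deriv

theorem pdH_sub_profile : pdH (fun R H => v R H - θ R) = pdH v := by
  funext R H
  simp [pdH]

theorem pdMix_succ_left (k l : ℕ) (g : ℝ → ℝ → ℝ) : pdMix (k + 1) l g = pdR (pdMix k l g) := by
  funext R H; simp only [pdMix, pdR, iteratedDeriv_succ]

theorem pdMix_zero_succ (l : ℕ) (g : ℝ → ℝ → ℝ) : pdMix 0 (l + 1) g = pdH (pdMix 0 l g) := by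
  funext R H; simp only [pdMix, pdH, iteratedDeriv_zero, iteratedDeriv_succ]

theorem pdMix_zero_zero (g : ℝ → ℝ → ℝ) : pdMix 0 0 g = g := by
  funext R H; simp [pdMix]

theorem bddHalfPlane_of_expDecay_sub (h : ExpDecay (fun R H => v R H - θ R)) {C : ℝ}
    (hC : ∀ R, |θ R| ≤ C) : BddHalfPlane v := by
  simpa using h.bdd.add (⟨C, fun R _ _ => hC R⟩ : BddHalfPlane (fun R _ => θ R))

end PerturbedProfile

theorem exists_abs_comp_le_of_mem_Icc {θ h : ℝ → ℝ} {a b : ℝ} (hθ : ∀ z, θ z ∈ Set.Icc a b)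
    (hh : Continuous h) : ∃ C, ∀ z, |h (θ z)| ≤ C := by
  obtain ⟨C, hC⟩ := isCompact_Icc.exists_bound_of_continuousOn (s := Set.Icc a b) hh.continuousOn
  exact ⟨C, fun z => hC _ (hθ z)⟩

/-- the compatibility condition
`∫_{ℝ²₊} G ∂_R v + ∫_ℝ g ∂_R v(·,0) = 0` for the data `G, g` obtained by applying the
linearized operator (linearization at a decaying solution `v` of the nonlinear
half-plane problem) to an exponentially decaying function `u`. Here
`A_α = [[1, −cos α],[−cos α, 1]]`, so `−div(A_α∇u) = −∂_R²u + 2cos α ∂_R∂_H u − ∂_H²u`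
and `N_{∂ℝ²₊}·A_α∇u = cos α ∂_R u − ∂_H u` at `H = 0`. -/
theorem linearized_halfplane_compatibility
    (f : ℝ → ℝ) (hf : ContDiff ℝ (⊤ : ℕ∞) f)
    (hf'm : deriv f (-1) = 0) (hf'p : deriv f 1 = 0)
    (hf''m : 0 < deriv (deriv f) (-1)) (hf''p : 0 < deriv (deriv f) 1)
    (hfeq : f (-1) = f 1)
    (hfgt : ∀ r ∈ Set.Ioo (-1 : ℝ) 1, f 1 < f r)
    (θ₀ : ℝ → ℝ) (hθsm : ContDiff ℝ (⊤ : ℕ∞) θ₀)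
    (hode : ∀ z : ℝ, -deriv (deriv θ₀) z + deriv f (θ₀ z) = 0)
    (hzero : θ₀ 0 = 0)
    (htop : Tendsto θ₀ atTop (nhds 1)) (hbot : Tendsto θ₀ atBot (nhds (-1)))
    (hθ' : ∀ z : ℝ, deriv θ₀ z = Real.sqrt (2 * (f (θ₀ z) - f (-1))))
    (hθ'pos : ∀ z : ℝ, 0 < deriv θ₀ z)
    (α : ℝ) (hα : α ∈ Set.Ioo 0 π)
    (σ : ℝ → ℝ) (hσ : ContDiff ℝ (⊤ : ℕ∞) σ)
    (hσ' : ∀ r : ℝ, r ∉ Set.Ioo (-1 : ℝ) 1 → deriv σ r = 0)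
    (v : ℝ → ℝ → ℝ) (hv : ContDiff ℝ (⊤ : ℕ∞) (fun p : ℝ × ℝ => v p.1 p.2))
    (hpde : ∀ R : ℝ, ∀ H : ℝ, 0 < H →
      -pdR (pdR v) R H + 2 * Real.cos α * pdR (pdH v) R H - pdH (pdH v) R H
        + deriv f (v R H) = 0)
    (hbc : ∀ R : ℝ,
      Real.cos α * pdR v R 0 - pdH v R 0 + deriv σ (v R 0) = 0)
    (hdec : ∀ k l : ℕ, ∃ c > (0:ℝ), ∃ C > (0:ℝ), ∀ R : ℝ, ∀ H : ℝ, 0 ≤ H →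
      |pdMix k l (fun R' H' => v R' H' - θ₀ R') R H| ≤ C * Real.exp (-c * (|R| + H)))
    (u : ℝ → ℝ → ℝ) (hu : ContDiff ℝ (⊤ : ℕ∞) (fun p : ℝ × ℝ => u p.1 p.2))
    (hudec : ∀ k l : ℕ, k + l ≤ 2 →
      ∃ c > (0:ℝ), ∃ C > (0:ℝ), ∀ R : ℝ, ∀ H : ℝ, 0 ≤ H →
        |pdMix k l u R H| ≤ C * Real.exp (-c * (|R| + H)))
    (G : ℝ → ℝ → ℝ)
    (hG : ∀ R H : ℝ, G R H =
      -pdR (pdR u) R H + 2 * Real.cos α * pdR (pdH u) R H - pdH (pdH u) R H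
        + deriv (deriv f) (v R H) * u R H)
    (g : ℝ → ℝ)
    (hg : ∀ R : ℝ, g R =
      Real.cos α * pdR u R 0 - pdH u R 0 + deriv (deriv σ) (v R 0) * u R 0) :
    (∫ p in (Set.univ ×ˢ Set.Ioi (0:ℝ) : Set (ℝ × ℝ)), G p.1 p.2 * pdR v p.1 p.2)
      + (∫ R : ℝ, g R * pdR v R 0) = 0 := by
  have hdf : ContDiff ℝ (⊤ : ℕ∞) (deriv f) := (contDiff_infty_iff_deriv.1 hf).2
  have hddf : ContDiff ℝ (⊤ : ℕ∞) (deriv (deriv f)) := (contDiff_infty_iff_deriv.1 hdf).2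
  have hdσ : ContDiff ℝ (⊤ : ℕ∞) (deriv σ) := (contDiff_infty_iff_deriv.1 hσ).2
  have hdθ : ContDiff ℝ (⊤ : ℕ∞) (deriv θ₀) := (contDiff_infty_iff_deriv.1 hθsm).2
  have hddθ : ContDiff ℝ (⊤ : ℕ∞) (deriv (deriv θ₀)) := (contDiff_infty_iff_deriv.1 hdθ).2
  have hvR := contDiff_pdR hv
  have hvH := contDiff_pdH hv
  have hvRR := contDiff_pdR hvR
  -- the profile and its derivatives are bounded
  have hmono : Monotone θ₀ := (strictMono_of_deriv_pos hθ'pos).monotone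
  have hmem : ∀ z, θ₀ z ∈ Set.Icc (-1 : ℝ) 1 := fun z =>
    ⟨hmono.le_of_tendsto hbot z, hmono.ge_of_tendsto htop z⟩
  obtain ⟨C₁, hC₁⟩ : ∃ C, ∀ z, |deriv θ₀ z| ≤ C := by
    simp only [hθ']
    exact exists_abs_comp_le_of_mem_Icc (h := fun r => Real.sqrt (2 * (f r - f (-1)))) hmem
      (by have := hf.continuous; fun_prop)
  have hθ2 : deriv (deriv θ₀) = fun z => deriv f (θ₀ z) := by
    funext z
    linarith [hode z]
  obtain ⟨C₂, hC₂⟩ : ∃ C, ∀ z, |deriv (deriv θ₀) z| ≤ C := by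
    rw [hθ2]
    exact exists_abs_comp_le_of_mem_Icc hmem hdf.continuous
  obtain ⟨C₃, hC₃⟩ : ∃ C, ∀ z, |deriv (deriv (deriv θ₀)) z| ≤ C := by
    obtain ⟨C, hC⟩ := exists_abs_comp_le_of_mem_Icc hmem hddf.continuous
    refine ⟨C * C₁, fun z => ?_⟩
    have hd : deriv (deriv (deriv θ₀)) z = deriv (deriv f) (θ₀ z) * deriv θ₀ z := by
      rw [hθ2]
      exact ((hdf.differentiable (by simp) (θ₀ z)).hasDerivAt.comp z
        (hθsm.differentiable (by simp) z).hasDerivAt).deriv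
    rw [hd, abs_mul]
    exact mul_le_mul (hC z) (hC₁ z) (abs_nonneg _) ((abs_nonneg _).trans (hC z))
  -- hence so are the derivatives of `v`
  have hd : ∀ k l, ExpDecay (pdMix k l (fun R' H' => v R' H' - θ₀ R')) := hdec
  have vR : BddHalfPlane (pdR v) := by
    have h := hd 1 0
    simp only [pdMix_succ_left, pdMix_zero_zero,
      pdR_sub_profile hv (hθsm.differentiable (by simp))] at h
    exact bddHalfPlane_of_expDecay_sub h hC₁
  have vRR : BddHalfPlane (pdR (pdR v)) := by
    have h := hd 2 0
    simp only [pdMix_succ_left, pdMix_zero_zero,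
      pdR_sub_profile hv (hθsm.differentiable (by simp)),
      pdR_sub_profile hvR (hdθ.differentiable (by simp))] at h
    exact bddHalfPlane_of_expDecay_sub h hC₂
  have vRRR : BddHalfPlane (pdR (pdR (pdR v))) := by
    have h := hd 3 0
    simp only [pdMix_succ_left, pdMix_zero_zero,
      pdR_sub_profile hv (hθsm.differentiable (by simp)),
      pdR_sub_profile hvR (hdθ.differentiable (by simp)),
      pdR_sub_profile hvRR (hddθ.differentiable (by simp))] at h
    exact bddHalfPlane_of_expDecay_sub h hC₃
  have vRH : BddHalfPlane (pdR (pdH v)) := by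
    have h := hd 1 1
    simp only [pdMix_succ_left, pdMix_zero_succ, pdMix_zero_zero, pdH_sub_profile] at h
    exact h.bdd
  have vRRH : BddHalfPlane (pdR (pdR (pdH v))) := by
    have h := hd 2 1
    simp only [pdMix_succ_left, pdMix_zero_succ, pdMix_zero_zero, pdH_sub_profile] at h
    exact h.bdd
  have vRHH : BddHalfPlane (pdR (pdH (pdH v))) := by
    have h := hd 1 2
    simp only [pdMix_succ_left, pdMix_zero_succ, pdMix_zero_zero, pdH_sub_profile] at h
    exact h.bdd
  have hw₁ : pdH (pdR v) = pdR (pdH v) := pdH_pdR hv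
  have hw₂ : pdH (pdH (pdR v)) = pdR (pdH (pdH v)) := by rw [hw₁, pdH_pdR hvH]
  have hud : ∀ k l, k + l ≤ 2 → ExpDecay (pdMix k l u) := hudec
  have u₀ := hud 0 0 (by norm_num)
  have uR := hud 1 0 (by norm_num)
  have uH := hud 0 1 (by norm_num)
  have uRR := hud 2 0 (by norm_num)
  have uRH := hud 1 1 (by norm_num)
  have uHH := hud 0 2 (by norm_num)
  simp only [pdMix_succ_left, pdMix_zero_succ, pdMix_zero_zero] at u₀ uR uH uRR uRH uHH
  have key := integral_green_halfPlane (Real.cos α) hu hvR u₀ uR uH uRR uRH uHH vR vRR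
    (by rwa [hw₁]) vRRR (by rwa [hw₁]) (by rwa [hw₂])
  -- `∂_R v` solves the linearized problem
  have hlin : ∀ R H, 0 < H → -pdR (pdR (pdR v)) R H + 2 * Real.cos α * pdR (pdR (pdH v)) R H
      - pdR (pdH (pdH v)) R H + deriv (deriv f) (v R H) * pdR v R H = 0 := by
    intro R H hH
    have h := ((((hasDerivAt_pdR hvRR R H).neg.add
      ((hasDerivAt_pdR (contDiff_pdR hvH) R H).const_mul (2 * Real.cos α))).sub
      (hasDerivAt_pdR (contDiff_pdH hvH) R H)).add
      ((hdf.differentiable (by simp) (v R H)).hasDerivAt.comp R (hasDerivAt_pdR hv R H)))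
    refine h.unique ((hasDerivAt_const R (0:ℝ)).congr_of_eventuallyEq
      (Eventually.of_forall fun r => ?_))
    exact hpde r H hH
  have hlinbc : ∀ R, Real.cos α * pdR (pdR v) R 0 - pdR (pdH v) R 0
      + deriv (deriv σ) (v R 0) * pdR v R 0 = 0 := by
    intro R
    have h := ((((hasDerivAt_pdR hvR R 0).const_mul (Real.cos α)).sub
      (hasDerivAt_pdR hvH R 0)).add
      ((hdσ.differentiable (by simp) (v R 0)).hasDerivAt.comp R (hasDerivAt_pdR hv R 0)))
    refine h.unique ((hasDerivAt_const R (0:ℝ)).congr_of_eventuallyEq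
      (Eventually.of_forall fun r => ?_))
    exact hbc r
  rw [hw₂, hw₁] at key
  have hint : ∫ p in (Set.univ ×ˢ Set.Ioi (0:ℝ) : Set (ℝ × ℝ)), G p.1 p.2 * pdR v p.1 p.2
      = -∫ p in (Set.univ ×ˢ Set.Ioi (0:ℝ) : Set (ℝ × ℝ)),
        (pdR v p.1 p.2 * (pdR (pdR u) p.1 p.2 - 2 * Real.cos α * pdR (pdH u) p.1 p.2
            + pdH (pdH u) p.1 p.2)
          - u p.1 p.2 * (pdR (pdR (pdR v)) p.1 p.2 - 2 * Real.cos α * pdR (pdR (pdH v)) p.1 p.2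
            + pdR (pdH (pdH v)) p.1 p.2)) := by
    rw [← integral_neg]
    refine setIntegral_congr_fun (MeasurableSet.univ.prod measurableSet_Ioi) fun p hp => ?_
    simp only [hG]
    linear_combination u p.1 p.2 * hlin p.1 p.2 hp.2
  have hbdry : ∫ R : ℝ, g R * pdR v R 0
      = -∫ R : ℝ, (pdR v R 0 * (pdH u R 0 - Real.cos α * pdR u R 0)
          - u R 0 * (pdR (pdH v) R 0 - Real.cos α * pdR (pdR v) R 0)) := by
    rw [← integral_neg]
    refine integral_congr_ae (ae_of_all _ fun R => ?_)
    simp only [hg]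
    linear_combination u R 0 * hlinbc R
  rw [hint, hbdry, key]
  ring
end

section
/- Let w : closure(Ω) → ℝ² be continuously differentiable with w(x) · N_{∂Ω}(x) ≥ 1 for all x ∈ ∂Ω. Then for every u that is continuously differentiable on an open neighbourhood of closure(Ω): ∫_{∂Ω} |u|³ dH¹ ≤ ∫_Ω (|div w(x)| |u(x)|³ + 3 |u(x)|² |w(x) · ∇u(x)|) dx. -/
open Filter Topology MeasureTheory
open scoped RealInnerProductSpace

noncomputable section

/-- The plane `ℝ²` as a Euclidean space. -/
abbrev E2 := EuclideanSpace ℝ (Fin 2)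

/-- The divergence of a vector field `w : ℝ² → ℝ²`. -/
def div2 (w : E2 → E2) (x : E2) : ℝ :=
  ∑ i : Fin 2, (fderiv ℝ w x (EuclideanSpace.single i 1)) i

/-- The divergence is the trace of the derivative, computed in any orthonormal basis. -/
theorem div2_eq_sum_inner (b : OrthonormalBasis (Fin 2) ℝ E2) (V : E2 → E2) (x : E2) :
    div2 V x = ∑ i, ⟪b i, fderiv ℝ V x (b i)⟫ := by
  have h := LinearMap.trace_eq_sum_inner (fderiv ℝ V x : E2 →ₗ[ℝ] E2) b
  rw [LinearMap.trace_eq_sum_inner _ (EuclideanSpace.basisFun (Fin 2) ℝ)] at h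
  simpa [div2, EuclideanSpace.inner_single_left] using h

theorem norm_div2_le (V : E2 → E2) (x : E2) : ‖div2 V x‖ ≤ 2 * ‖fderiv ℝ V x‖ := by
  have h (i : Fin 2) :
      ‖(fderiv ℝ V x (EuclideanSpace.single i 1)) i‖ ≤ ‖fderiv ℝ V x‖ :=
    (PiLp.norm_apply_le _ i).trans <|
      ((fderiv ℝ V x).le_opNorm _).trans (by simp)
  calc ‖div2 V x‖ ≤ ∑ i : Fin 2, ‖(fderiv ℝ V x (EuclideanSpace.single i 1)) i‖ :=
        norm_sum_le _ _
    _ ≤ ∑ _i : Fin 2, ‖fderiv ℝ V x‖ := Finset.sum_le_sum fun i _ => h i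
    _ = 2 * ‖fderiv ℝ V x‖ := by simp

/-- A function which is `C¹` up to the boundary of a bounded open set has bounded derivative. -/
theorem exists_norm_fderiv_le_of_contDiffOn_closure
    {E F : Type*} [NormedAddCommGroup E] [NormedSpace ℝ E] [ProperSpace E]
    [NormedAddCommGroup F] [NormedSpace ℝ F]
    {Ω : Set E} (hΩ : IsOpen Ω) (hbdd : Bornology.IsBounded Ω) {f : E → F}
    (hf : ContDiffOn ℝ 1 f (closure Ω)) : ∃ C, ∀ x ∈ Ω, ‖fderiv ℝ f x‖ ≤ C := by
  have hK : IsCompact (closure Ω) := hbdd.isCompact_closure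
  have key : ∃ C, ∀ x ∈ closure Ω ∩ Ω, ‖fderiv ℝ f x‖ ≤ C := by
    refine hK.induction_on (p := fun s => ∃ C, ∀ x ∈ s ∩ Ω, ‖fderiv ℝ f x‖ ≤ C) ?_ ?_ ?_ ?_
    · exact ⟨0, by simp⟩
    · rintro s t hst ⟨C, hC⟩
      exact ⟨C, fun x hx => hC x ⟨hst hx.1, hx.2⟩⟩
    · rintro s t ⟨C, hC⟩ ⟨D, hD⟩
      refine ⟨max C D, ?_⟩
      rintro x ⟨hx | hx, hxΩ⟩
      · exact (hC x ⟨hx, hxΩ⟩).trans (le_max_left _ _)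
      · exact (hD x ⟨hx, hxΩ⟩).trans (le_max_right _ _)
    · intro x hx
      obtain ⟨v, hv, -, f', hf', hcont⟩ :=
        (contDiffWithinAt_succ_iff_hasFDerivWithinAt (n := 0) (by simp)).1
          (by simpa using hf x hx)
      rw [Set.insert_eq_of_mem hx] at hv
      have hxv : x ∈ v := mem_of_mem_nhdsWithin hx hv
      have hc : Tendsto f' (𝓝[v] x) (𝓝 (f' x)) := hcont.continuousWithinAt
      have hc' : ∀ᶠ y in 𝓝[v] x, ‖f' y‖ < ‖f' x‖ + 1 :=
        hc.norm.eventually_lt_const (lt_add_one _)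
      obtain ⟨O, hO, hOv⟩ := mem_nhdsWithin_iff_exists_mem_nhds_inter.1 hc'
      obtain ⟨O', hO', hOv'⟩ := mem_nhdsWithin_iff_exists_mem_nhds_inter.1 hv
      refine ⟨(interior (O ∩ O')) ∩ closure Ω, ?_, ‖f' x‖ + 1, ?_⟩
      · exact inter_mem (mem_nhdsWithin_of_mem_nhds (interior_mem_nhds.2 (inter_mem hO hO')))
          self_mem_nhdsWithin
      · rintro y ⟨⟨hyO, hyc⟩, hyΩ⟩
        have hyv : y ∈ v := hOv' ⟨(interior_subset hyO).2, hyc⟩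
        have hvy : v ∈ 𝓝 y := by
          filter_upwards [hΩ.mem_nhds hyΩ, isOpen_interior.mem_nhds hyO] with z hz hz'
          exact hOv' ⟨(interior_subset hz').2, subset_closure hz⟩
        rw [((hf' y hyv).hasFDerivAt hvy).fderiv]
        exact (hOv ⟨(interior_subset hyO).1, hyv⟩ : _ < _).le
  obtain ⟨C, hC⟩ := key
  exact ⟨C, fun x hx => hC x ⟨subset_closure hx, hx⟩⟩

theorem ContDiffOn.continuousOn_div2 {V : E2 → E2} {Ω : Set E2} (hΩ : IsOpen Ω)
    (hV : ContDiffOn ℝ 1 V Ω) : ContinuousOn (div2 V) Ω := by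
  have h := hV.continuousOn_fderiv_of_isOpen hΩ le_rfl
  unfold div2
  fun_prop

/-- A continuous bounded function on a bounded open set is integrable. -/
theorem integrableOn_of_continuousOn_of_bounded {f : E2 → ℝ} {Ω : Set E2} (hΩ : IsOpen Ω)
    (hbdd : Bornology.IsBounded Ω) (hf : ContinuousOn f Ω) {C : ℝ} (hC : ∀ x ∈ Ω, ‖f x‖ ≤ C) :
    IntegrableOn f Ω :=
  IntegrableOn.of_bound hbdd.measure_lt_top (hf.aestronglyMeasurable hΩ.measurableSet) C
    (ae_restrict_of_forall_mem hΩ.measurableSet hC)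

theorem ContDiffOn.integrableOn_div2 {V : E2 → E2} {Ω : Set E2} (hΩ : IsOpen Ω)
    (hbdd : Bornology.IsBounded Ω) (hV : ContDiffOn ℝ 1 V (closure Ω)) :
    IntegrableOn (div2 V) Ω := by
  obtain ⟨C, hC⟩ := exists_norm_fderiv_le_of_contDiffOn_closure hΩ hbdd hV
  refine integrableOn_of_continuousOn_of_bounded hΩ hbdd
    ((hV.mono subset_closure).continuousOn_div2 hΩ) (C := 2 * C) fun x hx => ?_
  exact (norm_div2_le V x).trans (by gcongr; exact hC x hx)

/-- The parametrization of the plane by an orthonormal frame at `x₀`, sheared along the graph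
of `γ`: the point with parameters `(s, τ)` lies at height `τ` over the graph. -/
def graphMap (b : OrthonormalBasis (Fin 2) ℝ E2) (x₀ : E2) (γ : ℝ → ℝ) (p : ℝ × ℝ) : E2 :=
  x₀ + (p.1 • b 0 + (γ p.1 + p.2) • b 1)

section GraphMap

variable (b : OrthonormalBasis (Fin 2) ℝ E2) (x₀ : E2) {γ : ℝ → ℝ}

theorem inner_graphMap_sub_zero (p : ℝ × ℝ) : ⟪b 0, graphMap b x₀ γ p - x₀⟫ = p.1 := by
  simp [graphMap, inner_add_right, inner_smul_right, b.inner_eq_ite]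

theorem inner_graphMap_sub_one (p : ℝ × ℝ) :
    ⟪b 1, graphMap b x₀ γ p - x₀⟫ = γ p.1 + p.2 := by
  simp [graphMap, inner_add_right, inner_smul_right, b.inner_eq_ite]

theorem graphMap_inner (x : E2) :
    graphMap b x₀ γ (⟪b 0, x - x₀⟫, ⟪b 1, x - x₀⟫ - γ ⟪b 0, x - x₀⟫) = x := by
  have h := b.sum_repr' (x - x₀)
  rw [Fin.sum_univ_two] at h
  simp [graphMap, h]

theorem graphMap_injective : Function.Injective (graphMap b x₀ γ) := by
  intro p q hpq
  have h0 := inner_graphMap_sub_zero b x₀ (γ := γ) p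
  have h1 := inner_graphMap_sub_one b x₀ (γ := γ) p
  rw [hpq, inner_graphMap_sub_zero] at h0
  rw [hpq, inner_graphMap_sub_one, h0] at h1
  exact Prod.ext h0.symm (by linarith)

theorem continuous_graphMap (hγ : Continuous γ) : Continuous (graphMap b x₀ γ) := by
  unfold graphMap
  fun_prop

theorem measurePreserving_graphMap (hγ : Continuous γ) :
    MeasurePreserving (graphMap b x₀ γ) := by
  have h1 : MeasurePreserving (fun p : ℝ × ℝ => (p.1, γ p.1 + p.2))
      ((volume : Measure ℝ).prod volume) ((volume : Measure ℝ).prod volume) :=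
    (MeasurePreserving.id volume).skew_product (g := fun s τ => γ s + τ)
      (by fun_prop) (ae_of_all _ fun s => map_add_left_eq_self volume (γ s))
  have h2 := (volume_preserving_finTwoArrow ℝ).symm
  have h3 := b.measurePreserving_repr_symm.comp (PiLp.volume_preserving_toLp (Fin 2))
  have h4 := (measurePreserving_add_left (volume : Measure E2) x₀).comp (h3.comp (h2.comp h1))
  have h5 : graphMap b x₀ γ = (fun x => x₀ + x) ∘ (b.repr.symm ∘ WithLp.toLp 2) ∘
      MeasurableEquiv.finTwoArrow.symm ∘ fun p : ℝ × ℝ => (p.1, γ p.1 + p.2) := by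
    ext1 p
    simp [graphMap, ← b.sum_repr_symm, Fin.sum_univ_two]
  rw [h5]
  exact h4

theorem measurableEmbedding_graphMap (hγ : Continuous γ) :
    MeasurableEmbedding (graphMap b x₀ γ) :=
  (continuous_graphMap b x₀ hγ).measurableEmbedding (graphMap_injective b x₀)

end GraphMap

/-- The divergence theorem in a half-plane for compactly supported functions. -/
theorem integral_halfPlane_deriv_add_deriv {A A' B B' : ℝ → ℝ → ℝ} {R : ℝ}
    (hA : ∀ s, ∀ τ < 0, HasDerivAt (A s) (A' s τ) τ)
    (hB : ∀ s, ∀ τ < 0, HasDerivAt (fun s => B s τ) (B' s τ) s)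
    (hA0 : ∀ s, ContinuousWithinAt (A s) (Set.Iic 0) 0)
    (hAR : ∀ s, ∀ τ < -R, A s τ = 0) (hBR : ∀ s τ, R < |s| → B s τ = 0)
    (hA'i : IntegrableOn (fun p : ℝ × ℝ => A' p.1 p.2) (Set.univ ×ˢ Set.Iio 0))
    (hB'i : IntegrableOn (fun p : ℝ × ℝ => B' p.1 p.2) (Set.univ ×ˢ Set.Iio 0)) :
    ∫ p in (Set.univ : Set ℝ) ×ˢ Set.Iio (0 : ℝ), (A' p.1 p.2 + B' p.1 p.2) = ∫ s, A s 0 := by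
  have hr : (volume : Measure (ℝ × ℝ)).restrict (Set.univ ×ˢ Set.Iio 0) =
      (volume : Measure ℝ).prod (volume.restrict (Set.Iio 0)) := by
    rw [Measure.volume_eq_prod, ← Measure.prod_restrict, Measure.restrict_univ]
  rw [IntegrableOn, hr] at hA'i hB'i
  rw [hr, integral_add hA'i hB'i, integral_prod _ hA'i, integral_prod_symm _ hB'i]
  have hBint : ∫ τ in Set.Iio (0 : ℝ), ∫ s, B' s τ = 0 := by
    refine integral_eq_zero_of_ae ?_
    filter_upwards [hB'i.prod_left_ae, ae_restrict_mem measurableSet_Iio] with τ hi hτ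
    have htop : Tendsto (fun s => B s τ) atTop (𝓝 0) :=
      tendsto_const_nhds.congr' <| (eventually_gt_atTop (max R 0)).mono fun s hs =>
        (hBR s τ (lt_of_lt_of_le ((le_max_left _ _).trans_lt hs) (le_abs_self s))).symm
    have hbot : Tendsto (fun s => B s τ) atBot (𝓝 0) :=
      tendsto_const_nhds.congr' <| (eventually_lt_atBot (-R)).mono fun s hs =>
        (hBR s τ (lt_of_lt_of_le (lt_neg.1 hs) (neg_le_abs s))).symm
    simpa using integral_of_hasDerivAt_of_tendsto (fun s => hB s τ hτ) hi hbot htop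
  rw [hBint, add_zero]
  refine integral_congr_ae ?_
  filter_upwards [hA'i.prod_right_ae] with s hi
  have hbot : Tendsto (A s) atBot (𝓝 0) :=
    tendsto_const_nhds.congr' <| (eventually_lt_atBot (-R)).mono fun τ hτ => (hAR s τ hτ).symm
  have := integral_Iic_of_hasDerivAt_of_tendsto (hA0 s) (hA s)
    (by rw [integrableOn_Iic_iff_integrableOn_Iio]; exact hi) hbot
  rwa [integral_Iic_eq_integral_Iio, sub_zero] at this

theorem integrableOn_of_continuousOn_of_norm_le {g k : ℝ × ℝ → ℝ} {S : Set (ℝ × ℝ)} {R : ℝ}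
    (hS : MeasurableSet S) (hg : ContinuousOn g S) (hk : Continuous k)
    (hgk : ∀ p ∈ S, ‖g p‖ ≤ k p) (hgR : ∀ p ∈ S, R < ‖p‖ → g p = 0) : IntegrableOn g S := by
  have hki : IntegrableOn k (Metric.closedBall 0 R) :=
    hk.continuousOn.integrableOn_compact (isCompact_closedBall 0 R)
  have hki' := (integrable_indicator_iff Metric.isClosed_closedBall.measurableSet).2 hki
  refine (hki'.integrableOn (s := S)).mono' (hg.aestronglyMeasurable hS)
    (ae_restrict_of_forall_mem hS fun p hp => ?_)
  by_cases hpR : p ∈ Metric.closedBall 0 R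
  · rw [Set.indicator_of_mem hpR]
    exact hgk p hp
  · rw [Set.indicator_of_notMem hpR, hgR p hp (by simpa using hpR), norm_zero]

/-- A set `Ω` which, inside the open set `W`, is the region below the graph of the `C¹` function
`γ` in the orthonormal frame `b` based at `x₀`. -/
structure IsSubgraphIn (b : OrthonormalBasis (Fin 2) ℝ E2) (x₀ : E2) (γ : ℝ → ℝ)
    (Ω W : Set E2) : Prop where
  contDiff : ContDiff ℝ 1 γ
  isOpen : IsOpen W
  mem_iff : ∀ p, graphMap b x₀ γ p ∈ W → (graphMap b x₀ γ p ∈ Ω ↔ p.2 < 0)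

namespace IsSubgraphIn

variable {b : OrthonormalBasis (Fin 2) ℝ E2} {x₀ : E2} {γ : ℝ → ℝ} {Ω W : Set E2}
  {V : E2 → E2}

theorem mem_closure (h : IsSubgraphIn b x₀ γ Ω W) {p : ℝ × ℝ} (hp : p.2 ≤ 0)
    (hpW : graphMap b x₀ γ p ∈ W) : graphMap b x₀ γ p ∈ closure Ω := by
  have hc := continuous_graphMap b x₀ h.contDiff.continuous
  have ht : Tendsto (fun τ : ℝ => graphMap b x₀ γ (p.1, τ)) (𝓝[<] p.2)
      (𝓝 (graphMap b x₀ γ p)) := by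
    have : Continuous (fun τ : ℝ => graphMap b x₀ γ (p.1, τ)) := by fun_prop
    exact (this.tendsto p.2).mono_left nhdsWithin_le_nhds
  refine mem_closure_of_tendsto ht ?_
  filter_upwards [ht (h.isOpen.mem_nhds hpW), self_mem_nhdsWithin] with τ hτ hτ'
  exact (h.mem_iff _ hτ).2 (lt_of_lt_of_le hτ' hp)

theorem contDiffAt (h : IsSubgraphIn b x₀ γ Ω W) (hΩ : IsOpen Ω)
    (hV : ContDiffOn ℝ 1 V (closure Ω)) (hVW : tsupport V ⊆ W) {p : ℝ × ℝ} (hp : p.2 < 0) :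
    ContDiffAt ℝ 1 V (graphMap b x₀ γ p) := by
  by_cases hpV : graphMap b x₀ γ p ∈ tsupport V
  · exact hV.contDiffAt (mem_of_superset
      (hΩ.mem_nhds ((h.mem_iff p (hVW hpV)).2 hp)) subset_closure)
  · exact contDiffAt_const.congr_of_eventuallyEq (notMem_tsupport_iff_eventuallyEq.1 hpV)

theorem continuousOn_comp_graphMap (h : IsSubgraphIn b x₀ γ Ω W)
    (hV : ContinuousOn V (closure Ω)) (hVW : tsupport V ⊆ W) :
    ContinuousOn (fun p => V (graphMap b x₀ γ p)) {p | p.2 ≤ 0} := by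
  intro p hp
  have hc := continuous_graphMap b x₀ h.contDiff.continuous
  by_cases hpV : graphMap b x₀ γ p ∈ tsupport V
  · have ht : Tendsto (graphMap b x₀ γ) (𝓝[{p | p.2 ≤ 0}] p)
        (𝓝[closure Ω] (graphMap b x₀ γ p)) := by
      refine tendsto_nhdsWithin_iff.2 ⟨(hc.tendsto p).mono_left nhdsWithin_le_nhds, ?_⟩
      filter_upwards [self_mem_nhdsWithin, mem_nhdsWithin_of_mem_nhds
        (hc.continuousAt.preimage_mem_nhds (h.isOpen.mem_nhds (hVW hpV)))] with q hq hqW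
      exact h.mem_closure hq hqW
    exact Tendsto.comp (hV _ (h.mem_closure hp (hVW hpV))) ht
  · have h0 : (fun p => V (graphMap b x₀ γ p)) =ᶠ[𝓝 p] fun _ => 0 :=
      hc.continuousAt.eventually (notMem_tsupport_iff_eventuallyEq.1 hpV)
    exact (continuousAt_const.congr h0.symm).continuousWithinAt

theorem exists_norm_le (h : IsSubgraphIn b x₀ γ Ω W) (hVc : HasCompactSupport V) :
    ∃ R, ∀ p, graphMap b x₀ γ p ∈ tsupport V → ‖p‖ ≤ R := by
  have hγ := h.contDiff.continuous
  have hG : Continuous fun x : E2 =>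
      ((⟪b 0, x - x₀⟫, ⟪b 1, x - x₀⟫ - γ ⟪b 0, x - x₀⟫) : ℝ × ℝ) := by fun_prop
  obtain ⟨R, hR⟩ := (hVc.isCompact.image hG).isBounded.exists_norm_le
  refine ⟨R, fun p hp => hR p ⟨_, hp, ?_⟩⟩
  exact graphMap_injective b x₀ (graphMap_inner b x₀ _)

theorem continuous_boundary (h : IsSubgraphIn b x₀ γ Ω W)
    (hV : ContinuousOn V (closure Ω)) (hVW : tsupport V ⊆ W) :
    Continuous fun s => ⟪V (graphMap b x₀ γ (s, 0)), b 1 - deriv γ s • b 0⟫ := by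
  have h1 : Continuous fun s => V (graphMap b x₀ γ (s, 0)) :=
    (h.continuousOn_comp_graphMap hV hVW).comp_continuous
      (f := fun s : ℝ => (s, (0 : ℝ))) (by fun_prop) (fun s => le_refl (0 : ℝ))
  have h2 := h.contDiff.continuous_deriv le_rfl
  exact h1.inner (by fun_prop)

theorem integrable_boundary (h : IsSubgraphIn b x₀ γ Ω W)
    (hV : ContinuousOn V (closure Ω)) (hVc : HasCompactSupport V) (hVW : tsupport V ⊆ W) :
    Integrable fun s => ⟪V (graphMap b x₀ γ (s, 0)), b 1 - deriv γ s • b 0⟫ := by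
  obtain ⟨R, hR⟩ := h.exists_norm_le hVc
  refine (h.continuous_boundary hV hVW).integrable_of_hasCompactSupport
    (HasCompactSupport.intro (isCompact_closedBall 0 R) fun s hs => ?_)
  rw [image_eq_zero_of_notMem_tsupport (f := V), inner_zero_left]
  intro hsV
  have := (norm_fst_le (s, (0 : ℝ))).trans (hR _ hsV)
  exact hs (by simpa using this)

/-- The divergence theorem for a vector field supported where `Ω` is a subgraph. -/
theorem integral_div2 (h : IsSubgraphIn b x₀ γ Ω W) (hΩ : IsOpen Ω)
    (hbdd : Bornology.IsBounded Ω) (hV : ContDiffOn ℝ 1 V (closure Ω))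
    (hVc : HasCompactSupport V) (hVW : tsupport V ⊆ W) :
    ∫ x in Ω, div2 V x = ∫ s, ⟪V (graphMap b x₀ γ (s, 0)), b 1 - deriv γ s • b 0⟫ := by
  set Ψ := graphMap b x₀ γ with hΨ
  have hγc := h.contDiff.continuous
  have hγ' := h.contDiff.continuous_deriv le_rfl
  have hΨc : Continuous Ψ := continuous_graphMap b x₀ hγc
  set S : Set (ℝ × ℝ) := Set.univ ×ˢ Set.Iio (0 : ℝ) with hSdef
  have hS : MeasurableSet S := MeasurableSet.univ.prod measurableSet_Iio
  have hemb : MeasurableEmbedding Ψ := measurableEmbedding_graphMap b x₀ hγc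
  have hmp : MeasurePreserving Ψ := measurePreserving_graphMap b x₀ hγc
  have hreg : ∫ x in Ω, div2 V x = ∫ x in Ψ '' S, div2 V x := by
    rw [← integral_indicator hΩ.measurableSet,
      ← integral_indicator (hemb.measurableSet_image.2 hS)]
    congr 1
    ext x
    by_cases hx : x ∈ tsupport V
    · have hxΨ : Ψ _ = x := graphMap_inner b x₀ x
      have hiff : x ∈ Ω ↔ x ∈ Ψ '' S := by
        rw [← hxΨ, hemb.injective.mem_set_image, h.mem_iff _ (by rw [← hΨ, hxΨ]; exact hVW hx)]
        simp [hSdef]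
      by_cases hxΩ : x ∈ Ω
      · rw [Set.indicator_of_mem hxΩ, Set.indicator_of_mem (hiff.1 hxΩ)]
      · rw [Set.indicator_of_notMem hxΩ, Set.indicator_of_notMem (hiff.not.1 hxΩ)]
    · have : div2 V x = 0 := by simp [div2, fderiv_of_notMem_tsupport ℝ hx]
      simp [Set.indicator, this]
  have hpre : Ψ ⁻¹' (Ψ '' S) = S := hemb.injective.preimage_image S
  rw [hreg, ← hmp.setIntegral_preimage_emb hemb, hpre]
  obtain ⟨R, hR⟩ := h.exists_norm_le hVc
  obtain ⟨C, hC⟩ := exists_norm_fderiv_le_of_contDiffOn_closure hΩ hbdd hV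
  have hC' : ∀ p ∈ S, ‖fderiv ℝ V (Ψ p)‖ ≤ max C 0 := by
    intro p hp
    by_cases hpV : Ψ p ∈ tsupport V
    · exact (hC _ ((h.mem_iff p (hVW hpV)).2 hp.2)).trans (le_max_left _ _)
    · simp [fderiv_of_notMem_tsupport ℝ hpV]
  have hfc : ContinuousOn (fun p => fderiv ℝ V (Ψ p)) S := fun p hp =>
    (ContinuousAt.comp (f := Ψ) ((h.contDiffAt hΩ hV hVW hp.2).continuousAt_fderiv one_ne_zero)
      hΨc.continuousAt).continuousWithinAt
  have hfd (p : ℝ × ℝ) (hp : p.2 < 0) : HasFDerivAt V (fderiv ℝ V (Ψ p)) (Ψ p) :=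
    ((h.contDiffAt hΩ hV hVW hp).differentiableAt one_ne_zero).hasFDerivAt
  have hV0 (p : ℝ × ℝ) (hp : R < ‖p‖) : Ψ p ∉ tsupport V := fun hpV => (hR p hpV).not_gt hp
  have hR1 (s τ : ℝ) (hs : R < |s|) : R < ‖(s, τ)‖ := hs.trans_le (norm_fst_le (s, τ))
  have hR2 (s τ : ℝ) (hτ : R < |τ|) : R < ‖(s, τ)‖ := hτ.trans_le (norm_snd_le (s, τ))
  have hb (i : Fin 2) : ‖b i‖ = 1 := b.norm_eq_one i
  have hdiv (p : ℝ × ℝ) : div2 V (Ψ p) =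
      ⟪fderiv ℝ V (Ψ p) (b 1), b 1 - deriv γ p.1 • b 0⟫ +
        ⟪fderiv ℝ V (Ψ p) (b 0 + deriv γ p.1 • b 1), b 0⟫ := by
    rw [div2_eq_sum_inner b, Fin.sum_univ_two, map_add, map_smul, inner_sub_right,
      inner_add_left, inner_smul_left, inner_smul_right, real_inner_comm _ (b 0),
      real_inner_comm _ (b 1)]
    simp only [conj_trivial]
    ring
  have hk : Continuous fun p : ℝ × ℝ => max C 0 * (1 + ‖deriv γ p.1‖) := by fun_prop
  simp only [hdiv]
  refine integral_halfPlane_deriv_add_deriv (R := R)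
    (A := fun s τ => ⟪V (Ψ (s, τ)), b 1 - deriv γ s • b 0⟫)
    (A' := fun s τ => ⟪fderiv ℝ V (Ψ (s, τ)) (b 1), b 1 - deriv γ s • b 0⟫)
    (B := fun s τ => ⟪V (Ψ (s, τ)), b 0⟫)
    (B' := fun s τ => ⟪fderiv ℝ V (Ψ (s, τ)) (b 0 + deriv γ s • b 1), b 0⟫)
    ?_ ?_ ?_ ?_ ?_ ?_ ?_
  · intro s τ hτ
    have hΨτ : HasDerivAt (fun τ => Ψ (s, τ)) (b 1) τ := by
      simpa [hΨ, graphMap] using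
        ((((hasDerivAt_id τ).const_add (γ s)).smul_const (b 1)).const_add (s • b 0)).const_add x₀
    simpa using ((hfd (s, τ) hτ).comp_hasDerivAt τ hΨτ).inner ℝ
      (hasDerivAt_const τ (b 1 - deriv γ s • b 0))
  · intro s τ hτ
    have hγs : HasDerivAt γ (deriv γ s) s :=
      (h.contDiff.differentiable one_ne_zero s).hasDerivAt
    have hΨs : HasDerivAt (fun s => Ψ (s, τ)) (b 0 + deriv γ s • b 1) s := by
      simpa [hΨ, graphMap] using
        (((hasDerivAt_id s).smul_const (b 0)).add
          ((hγs.add_const τ).smul_const (b 1))).const_add x₀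
    simpa using ((hfd (s, τ) hτ).comp_hasDerivAt s hΨs).inner ℝ (hasDerivAt_const s (b 0))
  · intro s
    have h1 : ContinuousWithinAt (fun τ => V (Ψ (s, τ))) (Set.Iic 0) 0 :=
      ContinuousWithinAt.comp (g := fun p => V (Ψ p)) (f := fun τ : ℝ => (s, τ))
        (h.continuousOn_comp_graphMap hV.continuousOn hVW (s, 0) (le_refl (0 : ℝ)))
        (by fun_prop) (fun τ hτ => hτ)
    exact h1.inner continuousWithinAt_const
  · intro s τ hτ
    have hτ' : R < |τ| := (lt_neg.1 hτ).trans_le (neg_le_abs τ)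
    simp [image_eq_zero_of_notMem_tsupport (hV0 _ (hR2 s τ hτ'))]
  · intro s τ hs
    simp [image_eq_zero_of_notMem_tsupport (hV0 _ (hR1 s τ hs))]
  · refine integrableOn_of_continuousOn_of_norm_le hS (by fun_prop) hk ?_ (R := R) ?_
    · intro p hp
      refine (norm_inner_le_norm _ _).trans (mul_le_mul ?_ ?_ (norm_nonneg _) (le_max_right _ _))
      · simpa [hb] using ((fderiv ℝ V (Ψ p)).le_opNorm (b 1)).trans
          (mul_le_mul_of_nonneg_right (hC' p hp) (norm_nonneg _))
      · exact (norm_sub_le _ _).trans (by simp [norm_smul, hb])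
    · intro p _ hpR
      simp [fderiv_of_notMem_tsupport ℝ (hV0 p hpR)]
  · refine integrableOn_of_continuousOn_of_norm_le hS (by fun_prop) hk ?_ (R := R) ?_
    · intro p hp
      refine (norm_inner_le_norm _ _).trans ?_
      rw [hb, mul_one]
      refine ((fderiv ℝ V (Ψ p)).le_opNorm _).trans
        (mul_le_mul (hC' p hp) ?_ (norm_nonneg _) (le_max_right _ _))
      exact (norm_add_le _ _).trans (by simp [norm_smul, hb])
    · intro p _ hpR
      simp [fderiv_of_notMem_tsupport ℝ (hV0 p hpR)]

end IsSubgraphIn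

theorem ContDiffAt.exists_contDiff_eventuallyEq {f : ℝ → ℝ} {a : ℝ} (hf : ContDiffAt ℝ 1 f a) :
    ∃ g : ℝ → ℝ, ContDiff ℝ 1 g ∧ g =ᶠ[𝓝 a] f := by
  obtain ⟨δ, hδ, hfδ⟩ := Metric.eventually_nhds_iff_ball.1 (hf.eventually (by simp))
  let χ : ContDiffBump a := ⟨δ / 4, δ / 2, by positivity, by linarith⟩
  refine ⟨fun s => χ s * f s, contDiff_iff_contDiffAt.2 fun s => ?_, ?_⟩
  · by_cases hs : s ∈ Metric.ball a δ
    · exact χ.contDiff.contDiffAt.mul (hfδ s hs)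
    · have hsχ : s ∉ tsupport χ := by
        rw [χ.tsupport_eq]
        intro h
        exact hs (Metric.closedBall_subset_ball (by change δ / 2 < δ; linarith) h)
      refine contDiffAt_const (c := (0 : ℝ)) |>.congr_of_eventuallyEq ?_
      filter_upwards [notMem_tsupport_iff_eventuallyEq.1 hsχ] with y hy
      simp [hy]
  · filter_upwards [χ.eventuallyEq_one] with y hy
    simp [hy]

/-- The implicit function theorem at a regular point of the zero set of `F`: in the orthonormal
frame given by the tangent and the gradient, `{F < 0}` is locally a subgraph, and the graph
parametrization of the zero set is nearly an isometry. -/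
theorem exists_isSubgraphIn_sublevel {F : E2 → ℝ} (hF : ContDiff ℝ 1 F) {x₀ : E2}
    (hx₀ : F x₀ = 0) (hgrad : gradient F x₀ ≠ 0) {K : NNReal} (hK : 1 < K) :
    ∃ (b : OrthonormalBasis (Fin 2) ℝ E2) (γ : ℝ → ℝ) (W : Set E2), x₀ ∈ W ∧
      Bornology.IsBounded W ∧ IsSubgraphIn b x₀ γ {x | F x < 0} W ∧
      (∀ p, graphMap b x₀ γ p ∈ W → (F (graphMap b x₀ γ p) = 0 ↔ p.2 = 0)) ∧
      LipschitzOnWith K (fun s => graphMap b x₀ γ (s, 0)) {s | graphMap b x₀ γ (s, 0) ∈ W} ∧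
      ∀ x ∈ W, 0 < ⟪gradient F x, b 1⟫ := by
  have hFd : Differentiable ℝ F := hF.differentiable one_ne_zero
  have hgc : Continuous (gradient F) := by
    unfold gradient
    exact (InnerProductSpace.toDual ℝ E2).symm.continuous.comp (hF.continuous_fderiv one_ne_zero)
  have hfg (x v : E2) : fderiv ℝ F x v = ⟪gradient F x, v⟫ := by simp [gradient]
  set n : E2 := ‖gradient F x₀‖⁻¹ • gradient F x₀ with hn
  have hnorm : ‖gradient F x₀‖ ≠ 0 := norm_ne_zero_iff.2 hgrad
  have hn1 : ‖n‖ = 1 := by simp [hn, norm_smul, hnorm]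
  obtain ⟨b, hb⟩ := Orthonormal.exists_orthonormalBasis_extension_of_card_eq (𝕜 := ℝ) (E := E2)
    (ι := Fin 2) (by simp) (v := fun _ => n) (s := {1}) (by
      refine ⟨fun i => hn1, fun i j hij => (hij (Subsingleton.elim i j)).elim⟩)
  have hb1 : b 1 = n := hb 1 rfl
  have hgb : gradient F x₀ = ‖gradient F x₀‖ • b 1 := by
    rw [hb1, hn, smul_smul, mul_inv_cancel₀ hnorm, one_smul]
  have hg1 : ⟪gradient F x₀, b 1⟫ = ‖gradient F x₀‖ := by
    rw [hgb, inner_smul_left, b.inner_eq_ite]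
    simp [norm_smul]
  have hg0 : ⟪gradient F x₀, b 0⟫ = 0 := by
    rw [hgb, inner_smul_left, b.inner_eq_ite]
    simp
  -- `F` in frame coordinates
  set f : ℝ × ℝ → ℝ := fun p => F (x₀ + (p.1 • b 0 + p.2 • b 1)) with hf
  have hfC : ContDiff ℝ 1 f := hF.comp (by fun_prop)
  have hfderiv (p q : ℝ × ℝ) : fderiv ℝ f p q =
      ⟪gradient F (x₀ + (p.1 • b 0 + p.2 • b 1)), q.1 • b 0 + q.2 • b 1⟫ := by
    have h1 : HasFDerivAt (fun p : ℝ × ℝ => x₀ + (p.1 • b 0 + p.2 • b 1))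
        ((ContinuousLinearMap.fst ℝ ℝ ℝ).smulRight (b 0) +
          (ContinuousLinearMap.snd ℝ ℝ ℝ).smulRight (b 1)) p :=
      ((hasFDerivAt_fst.smul_const (b 0)).add (hasFDerivAt_snd.smul_const (b 1))).const_add x₀
    have h2 : HasFDerivAt f _ p := (hFd _).hasFDerivAt.comp p h1
    rw [h2.fderiv, ContinuousLinearMap.comp_apply, hfg]
    rfl
  have cdf : ContDiffAt ℝ 1 f (0, 0) := hfC.contDiffAt
  have hinv : (fderiv ℝ f (0, 0) ∘L .inr ℝ ℝ ℝ).IsInvertible := by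
    refine ⟨ContinuousLinearEquiv.unitsEquivAut ℝ (Units.mk0 _ hnorm), ?_⟩
    ext
    simp [hfderiv, hg1]
  set γ₀ := cdf.implicitFunction one_ne_zero hinv with hγ₀
  have hγ₀0 : γ₀ 0 = 0 := cdf.implicitFunction_apply_self one_ne_zero hinv
  have hγ₀f : ∀ᶠ s in 𝓝 (0 : ℝ), f (s, γ₀ s) = 0 := by
    have := cdf.eventually_apply_implicitFunction one_ne_zero hinv
    simpa [hf, hx₀] using this
  have hγ₀' : HasStrictFDerivAt γ₀ (0 : ℝ →L[ℝ] ℝ) 0 := by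
    have h1 := cdf.hasStrictFDerivAt_implicitFunction one_ne_zero hinv
    have h2 : fderiv ℝ f (0, 0) ∘L .inl ℝ ℝ ℝ = 0 := by
      ext
      simp [hfderiv, hg0]
    rw [h2, ContinuousLinearMap.comp_zero, neg_zero] at h1
    exact h1
  obtain ⟨γ, hγC, hγeq⟩ :=
    (cdf.contDiffAt_implicitFunction one_ne_zero hinv).exists_contDiff_eventuallyEq
  have hγ0 : γ 0 = 0 := hγeq.eq_of_nhds.trans hγ₀0
  have hγf : ∀ᶠ s in 𝓝 (0 : ℝ), f (s, γ s) = 0 := by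
    filter_upwards [hγ₀f, hγeq] with s h1 h2
    rwa [h2]
  have hγ' : HasStrictFDerivAt γ (0 : ℝ →L[ℝ] ℝ) 0 := hγ₀'.congr_of_eventuallyEq hγeq.symm
  have hc' : HasStrictDerivAt (fun s => graphMap b x₀ γ (s, 0)) (b 0) 0 := by
    have h1 : HasStrictDerivAt γ 0 0 := by simpa using hγ'.hasStrictDerivAt
    have h2 := (((hasStrictDerivAt_id (0 : ℝ)).smul_const (b 0)).add
      (h1.smul_const (b 1))).const_add x₀
    simpa [graphMap] using h2
  obtain ⟨T, hT, hLip⟩ := hc'.hasStrictFDerivAt.exists_lipschitzOnWith_of_nnnorm_lt K (by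
    rw [← NNReal.coe_lt_coe]
    simpa using hK)
  have hpos : ∀ᶠ p in 𝓝 ((0 : ℝ), (0 : ℝ)),
      0 < ⟪gradient F (x₀ + (p.1 • b 0 + p.2 • b 1)), b 1⟫ := by
    have hc : Continuous fun p : ℝ × ℝ =>
        ⟪gradient F (x₀ + (p.1 • b 0 + p.2 • b 1)), b 1⟫ :=
      (hgc.comp (by fun_prop)).inner continuous_const
    refine (hc.tendsto _).eventually (lt_mem_nhds ?_)
    simpa [hg1] using hgrad
  obtain ⟨ρ₁, hρ₁, hρ₁pos⟩ := Metric.eventually_nhds_iff.1 hpos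
  have hpos' (s t : ℝ) (hs : |s| < ρ₁) (ht : |t| < ρ₁) :
      0 < ⟪gradient F (x₀ + (s • b 0 + t • b 1)), b 1⟫ := by
    refine hρ₁pos (y := (s, t)) ?_
    rw [Prod.dist_eq]
    simpa using ⟨hs, ht⟩
  have hγρ : ∀ᶠ s in 𝓝 (0 : ℝ), |γ s| < ρ₁ := by
    refine (hγC.continuous.abs.tendsto 0).eventually (gt_mem_nhds ?_)
    simpa [hγ0] using hρ₁
  obtain ⟨ρ₂, hρ₂, hρ₂all⟩ := Metric.eventually_nhds_iff.1 (hγf.and (hγρ.and hT))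
  set ρ := min ρ₁ ρ₂ with hρ
  have hρ0 : 0 < ρ := lt_min hρ₁ hρ₂
  have hall (s : ℝ) (hs : |s| < ρ) : f (s, γ s) = 0 ∧ |γ s| < ρ₁ ∧ s ∈ T :=
    hρ₂all (by simpa using hs.trans_le (min_le_right _ _))
  have hmono (s : ℝ) (hs : |s| < ρ) : StrictMonoOn (fun t => f (s, t)) (Set.Ioo (-ρ₁) ρ₁) := by
    refine strictMonoOn_of_deriv_pos (convex_Ioo _ _) ?_ fun t ht => ?_
    · exact (hfC.continuous.comp (by fun_prop)).continuousOn
    · rw [interior_Ioo] at ht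
      have h1 : HasDerivAt (fun t => f (s, t)) (fderiv ℝ f (s, t) (0, 1)) t :=
        (hfC.differentiable one_ne_zero (s, t)).hasFDerivAt.comp_hasDerivAt t
          ((hasDerivAt_const t s).prodMk (hasDerivAt_id t))
      rw [h1.deriv, hfderiv]
      simpa using hpos' s t (hs.trans_le (min_le_left _ _)) (abs_lt.2 ht)
  have hΨf (p : ℝ × ℝ) : F (graphMap b x₀ γ p) = f (p.1, γ p.1 + p.2) := rfl
  set W : Set E2 := {x | |⟪b 0, x - x₀⟫| < ρ ∧ |⟪b 1, x - x₀⟫| < ρ} ∩ Metric.ball x₀ 1 with hW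
  have hWp (p : ℝ × ℝ) (hp : graphMap b x₀ γ p ∈ W) : |p.1| < ρ ∧ |γ p.1 + p.2| < ρ := by
    have h1 := hp.1
    rwa [Set.mem_ofPred_eq, inner_graphMap_sub_zero, inner_graphMap_sub_one] at h1
  refine ⟨b, γ, W, ?_, Metric.isBounded_ball.subset Set.inter_subset_right,
    ⟨hγC, ?_, fun p hp => ?_⟩, fun p hp => ?_, ?_, fun x hx => ?_⟩
  · simp [hW, hρ0]
  · refine IsOpen.inter (IsOpen.inter ?_ ?_) Metric.isOpen_ball
    · exact isOpen_lt (f := fun x => |⟪b 0, x - x₀⟫|) (by fun_prop) continuous_const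
    · exact isOpen_lt (f := fun x => |⟪b 1, x - x₀⟫|) (by fun_prop) continuous_const
  · obtain ⟨h1, h2⟩ := hWp p hp
    obtain ⟨h3, h4, -⟩ := hall p.1 h1
    have h5 := (hmono p.1 h1).lt_iff_lt (abs_lt.1 (h2.trans_le (min_le_left _ _))) (abs_lt.1 h4)
    simp only [h3] at h5
    rw [Set.mem_ofPred_eq, hΨf, h5]
    exact ⟨fun h => by linarith, fun h => by linarith⟩
  · obtain ⟨h1, h2⟩ := hWp p hp
    obtain ⟨h3, h4, -⟩ := hall p.1 h1
    have h5 := (hmono p.1 h1).injOn.eq_iff (abs_lt.1 (h2.trans_le (min_le_left _ _)))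
      (abs_lt.1 h4)
    simp only [h3] at h5
    rw [hΨf, h5]
    exact ⟨fun h => by linarith, fun h => by linarith⟩
  · exact hLip.mono fun s hs => (hall s (hWp _ hs).1).2.2
  · have h1 := hpos' _ _ (hx.1.1.trans_le (min_le_left _ _)) (hx.1.2.trans_le (min_le_left _ _))
    have h2 := graphMap_inner b x₀ (γ := fun _ => 0) x
    simp only [graphMap, sub_zero, zero_add] at h2
    rwa [h2] at h1

/-- The boundary flux controls the boundary integral where the boundary is a nearly isometric
graph. -/
theorem IsSubgraphIn.lintegral_frontier_le {F : E2 → ℝ} (hF : Differentiable ℝ F)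
    {b : OrthonormalBasis (Fin 2) ℝ E2} {x₀ : E2} {γ : ℝ → ℝ} {W : Set E2} {K : NNReal}
    (h : IsSubgraphIn b x₀ γ {x | F x < 0} W)
    (hzero : ∀ p, graphMap b x₀ γ p ∈ W → (F (graphMap b x₀ γ p) = 0 ↔ p.2 = 0))
    (hLip : LipschitzOnWith K (fun s => graphMap b x₀ γ (s, 0))
      {s | graphMap b x₀ γ (s, 0) ∈ W})
    (hpos : ∀ x ∈ W, 0 < ⟪gradient F x, b 1⟫)
    {V : E2 → E2} (hV : ContinuousOn V (closure {x | F x < 0}))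
    (hVc : HasCompactSupport V) (hVW : tsupport V ⊆ W)
    (hVN : ∀ x, F x = 0 → 0 ≤ ⟪V x, ‖gradient F x‖⁻¹ • gradient F x⟫)
    {g : E2 → ℝ} (hgV : ∀ x, F x = 0 → g x ≤ ⟪V x, ‖gradient F x‖⁻¹ • gradient F x⟫) :
    0 ≤ ∫ s, ⟪V (graphMap b x₀ γ (s, 0)), b 1 - deriv γ s • b 0⟫ ∧
    ∫⁻ x in {x | F x = 0}, ENNReal.ofReal (g x) ∂μH[1] ≤
      K * ENNReal.ofReal (∫ s, ⟪V (graphMap b x₀ γ (s, 0)), b 1 - deriv γ s • b 0⟫) := by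
  set c : ℝ → E2 := fun s => graphMap b x₀ γ (s, 0) with hc
  set I : Set ℝ := {s | c s ∈ W} with hI
  set A : ℝ → ℝ := fun s => ⟪V (c s), b 1 - deriv γ s • b 0⟫ with hA
  have hcc : Continuous c :=
    (continuous_graphMap b x₀ h.contDiff.continuous).comp (by fun_prop)
  have hIo : IsOpen I := h.isOpen.preimage hcc
  have hFc (s : ℝ) (hs : s ∈ I) : F (c s) = 0 := (hzero (s, 0) hs).2 rfl
  have hflux (s : ℝ) (hs : s ∈ I) :
      ⟪V (c s), ‖gradient F (c s)‖⁻¹ • gradient F (c s)⟫ ≤ A s := by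
    have hγs : HasDerivAt γ (deriv γ s) s :=
      (h.contDiff.differentiable one_ne_zero s).hasDerivAt
    have hc' : HasDerivAt c (b 0 + deriv γ s • b 1) s := by
      simpa [hc, graphMap] using
        (((hasDerivAt_id s).smul_const (b 0)).add (hγs.smul_const (b 1))).const_add x₀
    have h1 := (hF (c s)).hasFDerivAt.comp_hasDerivAt s hc'
    have h2 : F ∘ c =ᶠ[𝓝 s] fun _ => 0 := by
      filter_upwards [hIo.mem_nhds hs] with r hr
      exact hFc r hr
    have h3 : ⟪gradient F (c s), b 0 + deriv γ s • b 1⟫ = 0 := by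
      have := h1.unique ((hasDerivAt_const s (0 : ℝ)).congr_of_eventuallyEq h2)
      simpa [gradient] using this
    set a := ⟪gradient F (c s), b 1⟫ with ha
    have ha0 : 0 < a := hpos _ hs
    have haN : a ≤ ‖gradient F (c s)‖ := by
      have := real_inner_le_norm (gradient F (c s)) (b 1)
      rwa [b.norm_eq_one, mul_one] at this
    have h4 : gradient F (c s) = a • (b 1 - deriv γ s • b 0) := by
      have h5 := b.sum_repr' (gradient F (c s))
      rw [Fin.sum_univ_two, real_inner_comm, real_inner_comm _ (b 1), ← ha] at h5
      rw [inner_add_right, inner_smul_right, ← ha] at h3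
      rw [← h5, eq_neg_of_add_eq_zero_left h3]
      module
    have h5 : ⟪V (c s), gradient F (c s)⟫ = a * A s := by
      rw [h4, inner_smul_right]
    have h6 := hVN _ (hFc s hs)
    rw [inner_smul_right, h5] at h6 ⊢
    have hN0 : 0 < ‖gradient F (c s)‖ := ha0.trans_le haN
    have hA0 : 0 ≤ A s := by
      rwa [mul_nonneg_iff_of_pos_left (by positivity),
        mul_nonneg_iff_of_pos_left ha0] at h6
    rw [← mul_assoc]
    refine mul_le_of_le_one_left hA0 ?_
    rw [inv_mul_le_one₀ hN0]
    exact haN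
  have hAnn (s : ℝ) : 0 ≤ A s := by
    by_cases hs : s ∈ I
    · exact (hVN _ (hFc s hs)).trans (hflux s hs)
    · simp [hA, image_eq_zero_of_notMem_tsupport fun hsV => hs (hVW hsV)]
  refine ⟨integral_nonneg hAnn, ?_⟩
  have hZ : MeasurableSet {x | F x = 0} :=
    (isClosed_eq hF.continuous continuous_const).measurableSet
  have hμ : (μH[1] : Measure E2).restrict (W ∩ {x | F x = 0}) ≤
      (K : ENNReal) • (volume.restrict I).map c := by
    refine Measure.le_iff.2 fun S hS => ?_
    rw [Measure.restrict_apply hS, Measure.smul_apply, Measure.map_apply hcc.measurable hS,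
      Measure.restrict_apply (hcc.measurable hS), smul_eq_mul, ← hausdorffMeasure_real]
    have hsub : S ∩ (W ∩ {x | F x = 0}) ⊆ c '' (c ⁻¹' S ∩ I) := by
      rintro x ⟨hxS, hxW, hxF⟩
      have hx := graphMap_inner b x₀ (γ := γ) x
      rw [← hx] at hxW
      have h0 := (hzero _ hxW).1 (by rw [hx]; exact hxF)
      simp only at h0
      rw [h0] at hx hxW
      exact ⟨_, ⟨by rw [Set.mem_preimage, hc]; simpa only [hx] using hxS, hxW⟩, hx⟩
    calc μH[1] (S ∩ (W ∩ {x | F x = 0})) ≤ μH[1] (c '' (c ⁻¹' S ∩ I)) := measure_mono hsub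
      _ ≤ K * μH[1] (c ⁻¹' S ∩ I) := by
        simpa using (hLip.mono Set.inter_subset_right).hausdorffMeasure_image_le zero_le_one
  calc ∫⁻ x in {x | F x = 0}, ENNReal.ofReal (g x) ∂μH[1]
      ≤ ∫⁻ x in {x | F x = 0}, W.indicator (fun x => ENNReal.ofReal (g x)) x ∂μH[1] := by
        refine setLIntegral_mono' hZ fun x hx => ?_
        by_cases hxW : x ∈ W
        · rw [Set.indicator_of_mem hxW]
        · have := hgV x hx
          rw [image_eq_zero_of_notMem_tsupport fun hxV => hxW (hVW hxV), inner_zero_left] at this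
          simp [ENNReal.ofReal_of_nonpos this]
    _ = ∫⁻ x in W ∩ {x | F x = 0}, ENNReal.ofReal (g x) ∂μH[1] :=
        setLIntegral_indicator h.isOpen.measurableSet _
    _ ≤ ∫⁻ x, ENNReal.ofReal (g x) ∂((K : ENNReal) • (volume.restrict I).map c) :=
        lintegral_mono' hμ le_rfl
    _ = K * ∫⁻ x, ENNReal.ofReal (g x) ∂((volume.restrict I).map c) := lintegral_smul_measure ..
    _ ≤ K * ∫⁻ s in I, ENNReal.ofReal (g (c s)) := by
        gcongr
        exact lintegral_map_le _ _
    _ ≤ K * ∫⁻ s in I, ENNReal.ofReal (A s) := by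
        refine mul_le_mul_right ?_ _
        refine setLIntegral_mono' hIo.measurableSet fun s hs => ?_
        exact ENNReal.ofReal_le_ofReal ((hgV _ (hFc s hs)).trans (hflux s hs))
    _ ≤ K * ∫⁻ s, ENNReal.ofReal (A s) := by
        gcongr
        exact Measure.restrict_le_self
    _ = K * ENNReal.ofReal (∫ s, A s) := by
        rw [ofReal_integral_eq_lintegral_ofReal (h.integrable_boundary hV hVc hVW)
          (ae_of_all _ hAnn)]

/-- Localized boundary estimate near any point of the closure of a smooth bounded sublevel set. -/
theorem exists_nhds_lintegral_frontier_le {F : E2 → ℝ} (hF : ContDiff ℝ 1 F)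
    (hbdd : Bornology.IsBounded {x | F x < 0}) (hgrad : ∀ x, F x = 0 → gradient F x ≠ 0)
    {K : NNReal} (hK : 1 < K) {x₀ : E2} (hx₀ : F x₀ ≤ 0) :
    ∃ W : Set E2, IsOpen W ∧ x₀ ∈ W ∧ ∀ (V : E2 → E2) (g : E2 → ℝ),
      ContDiffOn ℝ 1 V (closure {x | F x < 0}) → tsupport V ⊆ W →
      (∀ x, F x = 0 → 0 ≤ ⟪V x, ‖gradient F x‖⁻¹ • gradient F x⟫) →
      (∀ x, F x = 0 → g x ≤ ⟪V x, ‖gradient F x‖⁻¹ • gradient F x⟫) →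
      0 ≤ ∫ x in {x | F x < 0}, div2 V x ∧
      ∫⁻ x in {x | F x = 0}, ENNReal.ofReal (g x) ∂μH[1] ≤
        K * ENNReal.ofReal (∫ x in {x | F x < 0}, div2 V x) := by
  have hΩ : IsOpen {x | F x < 0} := isOpen_lt hF.continuous continuous_const
  rcases hx₀.lt_or_eq with hx₀ | hx₀
  · obtain ⟨r, hr, hrΩ⟩ := Metric.isOpen_iff.1 hΩ x₀ hx₀
    refine ⟨Metric.ball x₀ r, Metric.isOpen_ball, Metric.mem_ball_self hr,
      fun V g hV hVW hVN hgV => ?_⟩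
    have hVc : HasCompactSupport V :=
      (isCompact_closedBall x₀ r).of_isClosed_subset (isClosed_tsupport V)
        (hVW.trans Metric.ball_subset_closedBall)
    let b : OrthonormalBasis (Fin 2) ℝ E2 := EuclideanSpace.basisFun (Fin 2) ℝ
    have hneg (p : ℝ × ℝ) (hp : graphMap b x₀ (fun _ => r) p ∈ Metric.ball x₀ r) : p.2 < 0 := by
      have h1 := inner_graphMap_sub_one b x₀ (γ := fun _ => r) p
      have h2 := real_inner_le_norm (b 1) (graphMap b x₀ (fun _ => r) p - x₀)
      rw [b.norm_eq_one, one_mul, h1, ← dist_eq_norm] at h2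
      have h3 := Metric.mem_ball.1 hp
      linarith
    have hsub : IsSubgraphIn b x₀ (fun _ => r) {x | F x < 0} (Metric.ball x₀ r) :=
      ⟨contDiff_const, Metric.isOpen_ball, fun p hp => iff_of_true (hrΩ hp) (hneg p hp)⟩
    have hdiv : ∫ x in {x | F x < 0}, div2 V x = 0 := by
      rw [hsub.integral_div2 hΩ hbdd hV hVc hVW]
      refine integral_eq_zero_of_ae (ae_of_all _ fun s => ?_)
      have : graphMap b x₀ (fun _ => r) (s, 0) ∉ tsupport V :=
        fun h => lt_irrefl (0 : ℝ) (hneg _ (hVW h))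
      simp [image_eq_zero_of_notMem_tsupport this]
    refine ⟨hdiv.ge, ?_⟩
    have hg0 : ∫⁻ x in {x | F x = 0}, ENNReal.ofReal (g x) ∂μH[1] = 0 := by
      refine setLIntegral_eq_zero
        (isClosed_eq hF.continuous continuous_const).measurableSet fun x hx => ?_
      have hxV : x ∉ tsupport V := fun h => (hrΩ (hVW h)).ne hx
      have := hgV x hx
      rw [image_eq_zero_of_notMem_tsupport hxV, inner_zero_left] at this
      exact ENNReal.ofReal_of_nonpos this
    rw [hg0]
    exact zero_le
  · obtain ⟨b, γ, W, hxW, hWb, h, hzero, hLip, hpos⟩ :=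
      exists_isSubgraphIn_sublevel hF hx₀ (hgrad x₀ hx₀) hK
    refine ⟨W, h.isOpen, hxW, fun V g hV hVW hVN hgV => ?_⟩
    have hVc : HasCompactSupport V :=
      hWb.isCompact_closure.of_isClosed_subset (isClosed_tsupport V)
        (hVW.trans subset_closure)
    rw [h.integral_div2 hΩ hbdd hV hVc hVW]
    exact h.lintegral_frontier_le (hF.differentiable one_ne_zero) hzero hLip hpos
      hV.continuousOn hVc hVW hVN hgV

/-- The inequality form of the divergence theorem in a smooth bounded planar sublevel set. -/
theorem lintegral_zeroSet_le_integral_div2 {F : E2 → ℝ} (hF : ContDiff ℝ 1 F)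
    (hbdd : Bornology.IsBounded {x | F x < 0}) (hfr : frontier {x | F x < 0} = {x | F x = 0})
    (hgrad : ∀ x, F x = 0 → gradient F x ≠ 0)
    {V : E2 → E2} (hV : ContDiffOn ℝ 1 V (closure {x | F x < 0}))
    {g : E2 → ℝ} (hg : ContinuousOn g {x | F x = 0}) (hg0 : ∀ x, F x = 0 → 0 ≤ g x)
    (hgV : ∀ x, F x = 0 → g x ≤ ⟪V x, ‖gradient F x‖⁻¹ • gradient F x⟫) :
    ∫⁻ x in {x | F x = 0}, ENNReal.ofReal (g x) ∂μH[1] ≤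
      ENNReal.ofReal (∫ x in {x | F x < 0}, div2 V x) := by
  set Ω : Set E2 := {x | F x < 0} with hΩdef
  set Z : Set E2 := {x | F x = 0} with hZdef
  have hΩ : IsOpen Ω := isOpen_lt hF.continuous continuous_const
  have hZ : MeasurableSet Z := (isClosed_eq hF.continuous continuous_const).measurableSet
  have hZc : Z ⊆ closure Ω := hfr ▸ frontier_subset_closure
  have hcl : ∀ x ∈ closure Ω, F x ≤ 0 := fun x hx =>
    closure_minimal (fun y (hy : F y < 0) => hy.le) (isClosed_le hF.continuous continuous_const) hx
  have hcomp : IsCompact (closure Ω) := hbdd.isCompact_closure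
  have key (K : NNReal) (hK : 1 < K) :
      ∫⁻ x in Z, ENNReal.ofReal (g x) ∂μH[1] ≤
        K * ENNReal.ofReal (∫ x in Ω, div2 V x) := by
    choose W hWo hxW hWest using fun x : closure Ω =>
      exists_nhds_lintegral_frontier_le hF hbdd hgrad hK (hcl x x.2)
    obtain ⟨t, ht⟩ := hcomp.elim_finite_subcover W hWo
      fun x hx => Set.mem_iUnion.2 ⟨⟨x, hx⟩, hxW _⟩
    obtain ⟨ψ, hψ⟩ := SmoothPartitionOfUnity.exists_isSubordinate
      (modelWithCornersSelf ℝ E2) isClosed_closure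
      (fun i : t => W i) (fun i => hWo i) (by simpa [Set.iUnion_subtype] using ht)
    have hψC (i : t) : ContDiff ℝ 1 (ψ i) := (ψ i).contMDiff.contDiff.of_le (by simp)
    have hψsum (x : E2) (hx : x ∈ closure Ω) : ∑ i, ψ i x = 1 := by
      rw [← finsum_eq_sum_of_fintype]
      exact ψ.sum_eq_one hx
    have hVi (i : t) : ContDiffOn ℝ 1 (fun x => ψ i x • V x) (closure Ω) :=
      (hψC i).contDiffOn.smul hV
    have hinner (i : t) (x : E2) :
        ⟪ψ i x • V x, ‖gradient F x‖⁻¹ • gradient F x⟫ =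
          ψ i x * ⟪V x, ‖gradient F x‖⁻¹ • gradient F x⟫ := by
      rw [inner_smul_left, conj_trivial]
    have hest (i : t) := hWest i (fun x => ψ i x • V x) (fun x => ψ i x * g x) (hVi i)
      ((tsupport_smul_subset_left (ψ i) V).trans (hψ i))
      (fun x hx => by
        rw [hinner]
        exact mul_nonneg (ψ.nonneg i x) ((hg0 x hx).trans (hgV x hx)))
      (fun x hx => by
        rw [hinner]
        exact mul_le_mul_of_nonneg_left (hgV x hx) (ψ.nonneg i x))
    have hdiv : ∑ i, ∫ x in Ω, div2 (fun x => ψ i x • V x) x = ∫ x in Ω, div2 V x := by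
      rw [← integral_finsetSum _ fun i _ => (hVi i).integrableOn_div2 hΩ hbdd]
      refine setIntegral_congr_fun hΩ.measurableSet fun x hx => ?_
      have hxc : closure Ω ∈ 𝓝 x := mem_of_superset (hΩ.mem_nhds hx) subset_closure
      have hd (i : t) : DifferentiableAt ℝ (fun x => ψ i x • V x) x :=
        ((hVi i).contDiffAt hxc).differentiableAt one_ne_zero
      have hVeq : V =ᶠ[𝓝 x] fun y => ∑ i, ψ i y • V y := by
        filter_upwards [hxc] with y hy
        rw [← Finset.sum_smul, hψsum y hy, one_smul]
      simp only [div2]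
      rw [hVeq.fderiv_eq, fderiv_fun_sum fun i _ => hd i, Finset.sum_comm]
      simp
    calc ∫⁻ x in Z, ENNReal.ofReal (g x) ∂μH[1]
        = ∫⁻ x in Z, ∑ i, ENNReal.ofReal (ψ i x * g x) ∂μH[1] := by
          refine setLIntegral_congr_fun hZ fun x hx => ?_
          rw [← ENNReal.ofReal_sum_of_nonneg fun i _ => mul_nonneg (ψ.nonneg i x) (hg0 x hx),
            ← Finset.sum_mul, hψsum x (hZc hx), one_mul]
      _ = ∑ i, ∫⁻ x in Z, ENNReal.ofReal (ψ i x * g x) ∂μH[1] := by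
          refine lintegral_finsetSum' _ fun i _ => ?_
          exact (((hψC i).continuous.continuousOn.mul hg).aemeasurable hZ).ennreal_ofReal
      _ ≤ ∑ i, K * ENNReal.ofReal (∫ x in Ω, div2 (fun x => ψ i x • V x) x) :=
          Finset.sum_le_sum fun i _ => (hest i).2
      _ = K * ENNReal.ofReal (∫ x in Ω, div2 V x) := by
          rw [← Finset.mul_sum, ← ENNReal.ofReal_sum_of_nonneg fun i _ => (hest i).1, hdiv]
  have hlim : Tendsto (fun K : NNReal => (K : ENNReal) * ENNReal.ofReal (∫ x in Ω, div2 V x))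
      (𝓝[>] 1) (𝓝 (((1 : NNReal) : ENNReal) * ENNReal.ofReal (∫ x in Ω, div2 V x))) :=
    ENNReal.Tendsto.mul_const
      ((ENNReal.continuous_coe.tendsto 1).mono_left nhdsWithin_le_nhds)
      (Or.inr ENNReal.ofReal_ne_top)
  rw [ENNReal.coe_one, one_mul] at hlim
  exact ge_of_tendsto hlim (eventually_nhdsWithin_of_forall key)

theorem hasDerivAt_abs_pow_three (z : ℝ) : HasDerivAt (fun z : ℝ => |z| ^ 3) (3 * |z| * z) z := by
  have h := hasDerivAt_abs_rpow z (p := 3) (by norm_num)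
  norm_num at h
  exact_mod_cast h

theorem contDiff_abs_pow_three : ContDiff ℝ 1 fun z : ℝ => |z| ^ 3 := by
  have h := contDiff_norm_rpow (E := ℝ) (p := 3) (by norm_num)
  exact_mod_cast h

theorem div2_smul {f : E2 → ℝ} {w : E2 → E2} {x : E2} (hf : DifferentiableAt ℝ f x)
    (hw : DifferentiableAt ℝ w x) :
    div2 (fun y => f y • w y) x = f x * div2 w x + fderiv ℝ f x (w x) := by
  have h : w x = ∑ i, w x i • EuclideanSpace.single i (1 : ℝ) := by
    ext i
    fin_cases i <;> simp
  conv_rhs => rw [h]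
  simp only [div2, fderiv_fun_smul hf hw, map_sum, map_smul, Finset.mul_sum,
    ← Finset.sum_add_distrib]
  refine Finset.sum_congr rfl fun i _ => ?_
  simp [mul_comm]

/-- for a `C¹` vector field `w` on `closure Ω` with `w · N ≥ 1` on `∂Ω`,
every `u` continuously differentiable on an open neighbourhood of `closure Ω` satisfies
`∫_{∂Ω} |u|³ dH¹ ≤ ∫_Ω (|div w| |u|³ + 3 |u|² |w·∇u|) dx`.
The bounded smooth domain `Ω ⊂ ℝ²` is described by a smooth defining function `F`
with nonvanishing gradient on the boundary, and `N = ∇F/|∇F|` is the outer unit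
normal on `∂Ω = frontier Ω`. -/
theorem boundary_cube_estimate
    (Ω : Set E2) (F : E2 → ℝ) (hF : ContDiff ℝ (⊤ : ℕ∞) F)
    (hΩF : Ω = {x : E2 | F x < 0}) (hfr : frontier Ω = {x : E2 | F x = 0})
    (hgradF : ∀ x ∈ frontier Ω, gradient F x ≠ 0)
    (hbdd : Bornology.IsBounded Ω) (hconn : IsConnected Ω)
    (N : E2 → E2) (hN : ∀ x ∈ frontier Ω, N x = ‖gradient F x‖⁻¹ • gradient F x)
    (w : E2 → E2) (hw : ContDiffOn ℝ 1 w (closure Ω))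
    (hwN : ∀ x ∈ frontier Ω, 1 ≤ ⟪w x, N x⟫) :
    ∀ u : E2 → ℝ,
      (∃ U : Set E2, IsOpen U ∧ closure Ω ⊆ U ∧ ContDiffOn ℝ 1 u U) →
      (∫ x in frontier Ω, |u x| ^ 3 ∂(μH[1]))
        ≤ ∫ x in Ω,
            (|div2 w x| * |u x| ^ 3 + 3 * |u x| ^ 2 * |⟪w x, gradient u x⟫|) := by
  rintro u ⟨U, hU, hΩU, hu⟩
  have hF1 : ContDiff ℝ 1 F := hF.of_le (by exact_mod_cast le_top)
  have hΩ : IsOpen Ω := hΩF ▸ isOpen_lt hF.continuous continuous_const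
  have huc : ContDiffOn ℝ 1 u (closure Ω) := hu.mono hΩU
  have hu3 : ContDiffOn ℝ 1 (fun x => |u x| ^ 3) (closure Ω) :=
    contDiff_abs_pow_three.comp_contDiffOn huc
  have hV : ContDiffOn ℝ 1 (fun x => |u x| ^ 3 • w x) (closure Ω) := hu3.smul hw
  have hcont : ContinuousOn (fun x => |u x| ^ 3) (frontier Ω) :=
    hu3.continuousOn.mono frontier_subset_closure
  have hbound : ∫⁻ x in frontier Ω, ENNReal.ofReal (|u x| ^ 3) ∂μH[1] ≤
      ENNReal.ofReal (∫ x in Ω, div2 (fun x => |u x| ^ 3 • w x) x) := by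
    rw [hfr] at hcont hgradF hN hwN ⊢
    subst hΩF
    refine lintegral_zeroSet_le_integral_div2 hF1 hbdd hfr hgradF hV hcont
      (fun x _ => by positivity) fun x hx => ?_
    rw [inner_smul_left, conj_trivial, ← hN x hx]
    exact le_mul_of_one_le_right (by positivity) (hwN x hx)
  have hpt (x : E2) (hx : x ∈ Ω) : div2 (fun x => |u x| ^ 3 • w x) x ≤
      |div2 w x| * |u x| ^ 3 + 3 * |u x| ^ 2 * |⟪w x, gradient u x⟫| := by
    have hxc : closure Ω ∈ 𝓝 x := mem_of_superset (hΩ.mem_nhds hx) subset_closure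
    have hud := (huc.contDiffAt hxc).differentiableAt one_ne_zero
    have hwd := (hw.contDiffAt hxc).differentiableAt one_ne_zero
    have hd : HasFDerivAt (fun x => |u x| ^ 3) ((3 * |u x| * u x) • fderiv ℝ u x) x :=
      (hasDerivAt_abs_pow_three (u x)).comp_hasFDerivAt x hud.hasFDerivAt
    have hg : ⟪w x, gradient u x⟫ = fderiv ℝ u x (w x) := by
      rw [real_inner_comm]
      simp [gradient]
    rw [div2_smul hd.differentiableAt hwd, hd.fderiv, hg, smul_apply,
      smul_eq_mul]
    refine add_le_add ?_ ?_
    · rw [mul_comm]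
      exact mul_le_mul_of_nonneg_right (le_abs_self _) (by positivity)
    · refine (le_abs_self _).trans_eq ?_
      rw [abs_mul, abs_mul, abs_mul, abs_abs, abs_of_pos (by norm_num : (0 : ℝ) < 3)]
      ring
  have hint : IntegrableOn
      (fun x => |div2 w x| * |u x| ^ 3 + 3 * |u x| ^ 2 * |⟪w x, gradient u x⟫|) Ω := by
    obtain ⟨Cw, hCw⟩ := exists_norm_fderiv_le_of_contDiffOn_closure hΩ hbdd hw
    obtain ⟨Cu, hCu⟩ := exists_norm_fderiv_le_of_contDiffOn_closure hΩ hbdd huc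
    obtain ⟨Mw, hMw⟩ := hbdd.isCompact_closure.exists_bound_of_continuousOn hw.continuousOn
    obtain ⟨Mu, hMu⟩ := hbdd.isCompact_closure.exists_bound_of_continuousOn huc.continuousOn
    have hdw := (hw.mono subset_closure).continuousOn_div2 hΩ
    have hwc := hw.continuousOn.mono (subset_closure (s := Ω))
    have huc' := huc.continuousOn.mono (subset_closure (s := Ω))
    have hgu : ContinuousOn (gradient u) Ω :=
      (InnerProductSpace.toDual ℝ E2).symm.continuous.comp_continuousOn
        ((huc.mono subset_closure).continuousOn_fderiv_of_isOpen hΩ le_rfl)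
    have hiu : ContinuousOn (fun x => ⟪w x, gradient u x⟫) Ω := hwc.inner hgu
    refine integrableOn_of_continuousOn_of_bounded hΩ hbdd (by fun_prop)
      (C := (2 * Cw) * Mu ^ 3 + 3 * Mu ^ 2 * (Mw * Cu)) fun x hx => ?_
    have h1 : |div2 w x| ≤ 2 * Cw :=
      (norm_div2_le w x).trans (mul_le_mul_of_nonneg_left (hCw x hx) zero_le_two)
    have h2 : |u x| ≤ Mu := hMu x (subset_closure hx)
    have h3 : |⟪w x, gradient u x⟫| ≤ Mw * Cu := by
      refine (abs_real_inner_le_norm _ _).trans ?_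
      have hgn : ‖gradient u x‖ = ‖fderiv ℝ u x‖ :=
        (InnerProductSpace.toDual ℝ E2).symm.norm_map _
      rw [hgn]
      exact mul_le_mul (hMw x (subset_closure hx)) (hCu x hx) (norm_nonneg _)
        ((norm_nonneg _).trans (hMw x (subset_closure hx)))
    have hMu0 : 0 ≤ Mu := (abs_nonneg _).trans h2
    have hCw0 : 0 ≤ 2 * Cw := (abs_nonneg _).trans h1
    rw [Real.norm_of_nonneg (by positivity)]
    gcongr
  rw [integral_eq_lintegral_of_nonneg_ae (ae_of_all _ fun x => by positivity)
    (hcont.aestronglyMeasurable isClosed_frontier.measurableSet)]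
  refine ENNReal.toReal_le_of_le_ofReal (integral_nonneg fun x => by positivity)
    (hbound.trans (ENNReal.ofReal_le_ofReal ?_))
  exact setIntegral_mono_on (hV.integrableOn_div2 hΩ hbdd) hint hΩ.measurableSet hpt
end
end
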